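/- arXiv:2005.01580 — 13 statements merged into one kernel-verified Lean document; each statement's English description precedes it below -/
import Mathlib

section
/- There exists a constant c0 > 0 such that for every real A > 0 there exist an integer N ≥ 1, points a_1, …, a_N ∈ [−A, A], and weights p_1, …, p_N > 0 with p_1 + … + p_N = 1, such that the Gaussian mixture density f(x) = Σ_{k=1}^N p_k·φ(x − a_k) has at least c0·A² modes; that is, there is a finite set S ⊆ ℝ with |S| ≥ c0·A² such that f attains a local maximum at every point of S. -/
/-- The standard Gaussian density on ℝ: φ(t) = (1/√(2π))·e^{−t²/2}. -/
noncomputable def stdGaussian (t : ℝ) : ℝ :=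
  (1 / Real.sqrt (2 * Real.pi)) * Real.exp (-t ^ 2 / 2)

open Real in
lemma aux_summable_sq {t : ℝ} (ht : 0 < t) :
    Summable (fun n : ℤ => rexp (-t * (n : ℝ) ^ 2)) ∧
      ∑' n : ℤ, rexp (-t * (n : ℝ) ^ 2) ≤ 2 * (1 + 1 / t) := by
  have hr0 : 0 ≤ rexp (-t) := (exp_pos _).le
  have hr1 : rexp (-t) < 1 := by rw [exp_lt_one_iff]; linarith
  have hg := summable_geometric_of_lt_one hr0 hr1
  have hb1 : ∀ n : ℕ, rexp (-t * (((n : ℕ) : ℤ) : ℝ) ^ 2) ≤ rexp (-t) ^ n := by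
    intro n
    rw [← exp_nat_mul]
    apply exp_le_exp.mpr
    have : (n : ℝ) ≤ (n : ℝ) ^ 2 := by exact_mod_cast Nat.le_self_pow two_ne_zero n
    push_cast
    nlinarith
  have hb2 : ∀ n : ℕ, rexp (-t * ((-((n : ℤ) + 1) : ℤ) : ℝ) ^ 2) ≤ rexp (-t) ^ n := by
    intro n
    rw [← exp_nat_mul]
    apply exp_le_exp.mpr
    have : (n : ℝ) ≤ ((n : ℝ) + 1) ^ 2 := by nlinarith [sq_nonneg (n : ℝ), Nat.cast_nonneg (α := ℝ) n]
    push_cast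
    nlinarith
  have s1 : Summable (fun n : ℕ => rexp (-t * (((n : ℕ) : ℤ) : ℝ) ^ 2)) :=
    Summable.of_nonneg_of_le (fun _ => (exp_pos _).le) hb1 hg
  have s2 : Summable (fun n : ℕ => rexp (-t * ((-((n : ℤ) + 1) : ℤ) : ℝ) ^ 2)) :=
    Summable.of_nonneg_of_le (fun _ => (exp_pos _).le) hb2 hg
  refine ⟨Summable.of_nat_of_neg_add_one (f := fun n : ℤ => rexp (-t * (n : ℝ) ^ 2)) s1 s2, ?_⟩
  rw [tsum_of_nat_of_neg_add_one (f := fun n : ℤ => rexp (-t * (n : ℝ) ^ 2)) s1 s2]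
  have e1 := s1.tsum_le_tsum hb1 hg
  have e2 := s2.tsum_le_tsum hb2 hg
  rw [tsum_geometric_of_lt_one hr0 hr1] at e1 e2
  have e3 : (1 - rexp (-t))⁻¹ ≤ 1 + 1 / t := by
    have h1 : t + 1 ≤ rexp t := add_one_le_exp t
    have h2 : rexp (-t) ≤ 1 / (t + 1) := by
      rw [exp_neg, ← one_div]
      exact one_div_le_one_div_of_le (by linarith) h1
    have h3 : t / (t + 1) ≤ 1 - rexp (-t) := by
      have : t / (t + 1) = 1 - 1 / (t + 1) := by field_simp; ring
      linarith
    calc (1 - rexp (-t))⁻¹ ≤ (t / (t + 1))⁻¹ := inv_anti₀ (by positivity) h3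
      _ = 1 + 1 / t := by field_simp; try ring
  linarith

open Real in
lemma aux_summable_shift {t : ℝ} (ht : 0 < t) (y : ℝ) :
    Summable (fun n : ℤ => rexp (-t * ((n : ℝ) + y) ^ 2)) := by
  have := ((aux_summable_sq (t := t / 2) (by linarith)).1).mul_left (rexp (t * y ^ 2))
  refine Summable.of_nonneg_of_le (fun _ => (exp_pos _).le) (fun n => ?_) this
  rw [← exp_add]
  apply exp_le_exp.mpr
  nlinarith [mul_nonneg ht.le (sq_nonneg ((n : ℝ) + 2 * y))]

open Real in
lemma aux_poisson {a : ℝ} (ha : 0 < a) (y : ℝ) :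
    ∑' n : ℤ, rexp (-(π / a) * ((n : ℝ) + y) ^ 2) =
      a ^ (1 / 2 : ℝ) * ∑' n : ℤ, rexp (-(π * a) * (n : ℝ) ^ 2) * cos (2 * π * y * n) := by
  have h := Complex.tsum_exp_neg_quadratic (a := (a : ℂ)) (by simpa using ha)
    (-Complex.I * (y : ℂ))
  have hR : ∀ n : ℤ, Complex.exp (-(π : ℂ) / a * ((n : ℂ) + Complex.I * (-Complex.I * (y : ℂ))) ^ 2)
      = ((rexp (-(π / a) * ((n : ℝ) + y) ^ 2) : ℝ) : ℂ) := by
    intro n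
    have : Complex.I * (-Complex.I * (y : ℂ)) = y := by
      linear_combination (-(y : ℂ)) * Complex.I_sq
    rw [this]
    push_cast
    congr 1
    ring
  have hL : ∀ n : ℤ, (Complex.exp (-(π : ℂ) * a * (n : ℂ) ^ 2
        + 2 * π * (-Complex.I * (y : ℂ)) * n)) =
      ((rexp (-(π * a) * (n : ℝ) ^ 2) : ℝ) : ℂ) *
        Complex.exp ((-(2 * π * y * n) : ℝ) * Complex.I) := by
    intro n
    push_cast
    rw [← Complex.exp_add]
    congr 1
    ring
  have hLre : ∀ n : ℤ, (Complex.exp (-(π : ℂ) * a * (n : ℂ) ^ 2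
        + 2 * π * (-Complex.I * (y : ℂ)) * n)).re =
      rexp (-(π * a) * (n : ℝ) ^ 2) * cos (2 * π * y * n) := by
    intro n
    rw [hL, Complex.re_ofReal_mul, Complex.exp_ofReal_mul_I_re, cos_neg]
  have hsum : Summable (fun n : ℤ => Complex.exp (-(π : ℂ) * a * (n : ℂ) ^ 2
        + 2 * π * (-Complex.I * (y : ℂ)) * n)) := by
    refine Summable.of_norm_bounded (aux_summable_sq (t := π * a) (by positivity)).1 (fun n => ?_)
    rw [hL, norm_mul, Complex.norm_exp_ofReal_mul_I, mul_one, Complex.norm_real,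
      Real.norm_of_nonneg (exp_pos _).le]
  have h2 := congrArg Complex.re h
  rw [Complex.re_tsum hsum] at h2
  simp_rw [hLre, hR] at h2
  rw [← Complex.ofReal_tsum] at h2
  have h3 : (1 : ℂ) / (a : ℂ) ^ (1 / 2 : ℂ) = ((1 / a ^ (1 / 2 : ℝ) : ℝ) : ℂ) := by
    rw [Complex.ofReal_div, Complex.ofReal_cpow ha.le]
    push_cast
    rfl
  rw [h3, ← Complex.ofReal_mul, Complex.ofReal_re] at h2
  rw [h2]
  have : (a ^ (1 / 2 : ℝ) : ℝ) ≠ 0 := (rpow_pos_of_pos ha _).ne'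
  field_simp

open Real in
lemma aux_gap {a : ℝ} (ha : 1 ≤ a) :
    rexp (-(π * a)) ≤ ∑' n : ℤ, rexp (-(π / a) * ((n : ℝ) + 0) ^ 2) -
      ∑' n : ℤ, rexp (-(π / a) * ((n : ℝ) + 1 / 2) ^ 2) := by
  have ha0 : 0 < a := by linarith
  have hs := (aux_summable_sq (t := π * a) (by positivity)).1
  have hsc : ∀ y : ℝ, Summable
      (fun n : ℤ => rexp (-(π * a) * (n : ℝ) ^ 2) * cos (2 * π * y * n)) := by
    intro y
    refine Summable.of_norm_bounded hs (fun n => ?_)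
    rw [norm_mul, Real.norm_of_nonneg (exp_pos _).le]
    exact mul_le_of_le_one_right (exp_pos _).le (abs_cos_le_one _)
  rw [aux_poisson ha0, aux_poisson ha0, ← mul_sub, ← (hsc _).tsum_sub (hsc _)]
  have h1 : 1 ≤ a ^ (1 / 2 : ℝ) := one_le_rpow ha (by norm_num)
  have hn : ∀ n : ℤ, 0 ≤ rexp (-(π * a) * (n : ℝ) ^ 2) * cos (2 * π * 0 * n)
      - rexp (-(π * a) * (n : ℝ) ^ 2) * cos (2 * π * (1 / 2) * n) := by
    intro n
    rw [← mul_sub]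
    apply mul_nonneg (exp_pos _).le
    simp [cos_le_one]
  have h2 := ((hsc 0).sub (hsc (1 / 2))).le_tsum 1 (fun n _ => hn n)
  have h3 : rexp (-(π * a)) ≤ rexp (-(π * a) * ((1 : ℤ) : ℝ) ^ 2) * cos (2 * π * 0 * (1 : ℤ))
      - rexp (-(π * a) * ((1 : ℤ) : ℝ) ^ 2) * cos (2 * π * (1 / 2) * (1 : ℤ)) := by
    have : 2 * π * (1 / 2) * ((1 : ℤ) : ℝ) = π := by push_cast; ring
    rw [this]
    simp
    positivity
  have h4 := h3.trans h2
  exact h4.trans (le_mul_of_one_le_left ((exp_pos _).le.trans h4) h1)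

lemma aux_localMax {f : ℝ → ℝ} (hf : Continuous f) {u v w : ℝ} (huv : u < v) (hvw : v < w)
    (h1 : f u < f v) (h2 : f w < f v) : ∃ x ∈ Set.Ioo u w, IsLocalMax f x := by
  obtain ⟨x, hx, hm⟩ := (isCompact_Icc (a := u) (b := w)).exists_isMaxOn
    ⟨v, huv.le, hvw.le⟩ hf.continuousOn
  have hv : f v ≤ f x := hm ⟨huv.le, hvw.le⟩
  have hxu : u < x := lt_of_le_of_ne hx.1 (by rintro rfl; linarith)
  have hxw : x < w := lt_of_le_of_ne hx.2 (by rintro rfl; linarith)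
  exact ⟨x, ⟨hxu, hxw⟩, hm.isLocalMax (Icc_mem_nhds hxu hxw)⟩

/-- Unnormalised truncated lattice sum. -/
noncomputable def auxG (h : ℝ) (K : ℕ) (x : ℝ) : ℝ :=
  ∑ k ∈ Finset.Icc (-(K : ℤ)) K, Real.exp (-(x - h * k) ^ 2 / 2)

open Real in
lemma auxG_upper {h : ℝ} (hh : 0 < h) (K : ℕ) (j : ℤ) :
    auxG h K (h * (j + 1 / 2)) ≤ ∑' n : ℤ, rexp (-(h ^ 2 / 2) * ((n : ℝ) + 1 / 2) ^ 2) := by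
  have hs := aux_summable_shift (t := h ^ 2 / 2) (by positivity) (1 / 2)
  have hs' := (Equiv.subLeft j).summable_iff.mpr hs
  rw [← (Equiv.subLeft j).tsum_eq]
  refine le_trans (le_of_eq ?_)
    (hs'.sum_le_tsum (Finset.Icc (-(K : ℤ)) K) (fun _ _ => (exp_pos _).le))
  unfold auxG
  refine Finset.sum_congr rfl (fun k _ => ?_)
  simp only [Function.comp, Equiv.subLeft_apply]
  congr 1
  push_cast
  ring

open Real in
lemma auxG_lower {h A : ℝ} (hh : 0 < h) (hA : 0 < A) (K : ℕ) (hK : A < h * (K + 1)) (j : ℤ)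
    (hj : |h * j| ≤ A / 2) :
    ∑' n : ℤ, rexp (-(h ^ 2 / 2) * ((n : ℝ) + 0) ^ 2)
      - rexp (-A ^ 2 / 16) * ∑' n : ℤ, rexp (-(h ^ 2 / 4) * (n : ℝ) ^ 2) ≤ auxG h K (h * j) := by
  have hs := aux_summable_shift (t := h ^ 2 / 2) (by positivity) 0
  have hs2 := ((aux_summable_sq (t := h ^ 2 / 4) (by positivity)).1).mul_left (rexp (-A ^ 2 / 16))
  rw [← tsum_mul_left, ← hs.tsum_sub hs2, ← (Equiv.subLeft j).tsum_eq]
  have hd := (Equiv.subLeft j).summable_iff.mpr (hs.sub hs2)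
  have key := hd.neg.sum_le_tsum (Finset.Icc (-(K : ℤ)) K) (fun k hk => ?_)
  · rw [tsum_neg, Finset.sum_neg_distrib] at key
    refine (neg_le_neg_iff.mp key).trans ?_
    unfold auxG
    refine Finset.sum_le_sum (fun k _ => ?_)
    simp only [Function.comp, Equiv.subLeft_apply]
    have : rexp (-(h ^ 2 / 2) * (((j - k : ℤ) : ℝ) + 0) ^ 2) = rexp (-(h * j - h * k) ^ 2 / 2) := by
      congr 1
      push_cast
      ring
    rw [this]
    have := mul_pos (exp_pos (-A ^ 2 / 16)) (exp_pos (-(h ^ 2 / 4) * ((j - k : ℤ) : ℝ) ^ 2))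
    linarith
  · simp only [Function.comp, Equiv.subLeft_apply]
    rw [neg_nonneg, sub_nonpos, ← exp_add]
    apply exp_le_exp.mpr
    have hk' : (K : ℝ) + 1 ≤ |(k : ℝ)| := by
      rw [Finset.mem_Icc, not_and_or] at hk
      have : (K : ℤ) + 1 ≤ |k| := by
        rcases hk with hk | hk
        · have := neg_abs_le k
          omega
        · have := le_abs_self k
          omega
      exact_mod_cast this
    have h1 : A ≤ |h * (k : ℝ)| := by
      rw [abs_mul, abs_of_pos hh]
      nlinarith
    have h2 : A / 2 ≤ |h * (j : ℝ) - h * k| := by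
      have := abs_sub_abs_le_abs_sub (h * (k : ℝ)) (h * j)
      rw [abs_sub_comm] at this
      linarith
    have h3 : (A / 2) ^ 2 ≤ (h * (j : ℝ) - h * k) ^ 2 := by
      rw [← sq_abs (h * (j : ℝ) - h * k)]
      exact pow_le_pow_left₀ (by linarith) h2 2
    push_cast
    nlinarith

open Real in
lemma aux_numeric {A : ℝ} (hA : 100 ≤ A) :
    rexp (-A ^ 2 / 16) * (2 * (1 + 1 / ((100 / A) ^ 2 / 4))) <
      rexp (-(π * (2 * π / (100 / A) ^ 2))) := by
  have hA0 : 0 < A := by linarith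
  have h1 : rexp (-A ^ 2 / 400) ≤ rexp (-(π * (2 * π / (100 / A) ^ 2))) := by
    apply exp_le_exp.mpr
    have : π * (2 * π / (100 / A) ^ 2) = 2 * π ^ 2 * A ^ 2 / 10000 := by field_simp; try norm_num
    rw [this]
    have hp : π ^ 2 ≤ 3.15 ^ 2 := pow_le_pow_left₀ pi_pos.le pi_lt_d2.le 2
    have := mul_le_mul_of_nonneg_right hp (sq_nonneg A)
    nlinarith [sq_nonneg A]
  refine lt_of_lt_of_le ?_ h1
  have h2 : rexp (-A ^ 2 / 400) = rexp (-A ^ 2 / 16) * rexp (6 / 100 * A ^ 2) := by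
    rw [← exp_add]; congr 1; ring
  rw [h2]
  apply mul_lt_mul_of_pos_left _ (exp_pos _)
  have h3 := add_one_le_exp (6 / 100 * A ^ 2)
  have h4 : 1 / ((100 / A) ^ 2 / 4) = A ^ 2 / 2500 := by field_simp; norm_num
  rw [h4]
  nlinarith

open Real in
lemma aux_main {A : ℝ} (hA : 100 ≤ A) (j : ℕ) (K : ℕ) (hK : A < 100 / A * (K + 1))
    (hj : 100 / A * (j : ℝ) ≤ A / 2) :
    ∃ x ∈ Set.Ioo (100 / A * ((j : ℝ) - 1 / 2)) (100 / A * ((j : ℝ) + 1 / 2)),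
      IsLocalMax (auxG (100 / A) K) x := by
  have hA0 : 0 < A := by linarith
  have hh : 0 < 100 / A := by positivity
  set h := 100 / A with hdef
  have hcont : Continuous (auxG h K) := by unfold auxG; fun_prop
  have hh1 : h ≤ 1 := by rw [hdef, div_le_one hA0]; exact hA
  have ha : 1 ≤ 2 * π / h ^ 2 := by
    rw [le_div_iff₀ (by positivity)]
    nlinarith [pi_gt_three]
  have hgap := aux_gap ha
  have e : π / (2 * π / h ^ 2) = h ^ 2 / 2 := by field_simp
  rw [e] at hgap
  have hlow := auxG_lower hh hA0 K hK (j : ℤ) (by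
    push_cast; rw [abs_of_nonneg (by positivity)]; exact hj)
  have hB := (aux_summable_sq (t := h ^ 2 / 4) (by positivity)).2
  have hB' := mul_le_mul_of_nonneg_left hB (exp_pos (-A ^ 2 / 16)).le
  have hnum := aux_numeric hA
  rw [← hdef] at hnum
  have hu1 := auxG_upper hh K (j : ℤ)
  have hu2 := auxG_upper hh K ((j : ℤ) - 1)
  push_cast at hlow hu1 hu2
  have e2 : (j : ℝ) - 1 + 1 / 2 = j - 1 / 2 := by ring
  rw [e2] at hu2
  refine aux_localMax hcont (v := h * j) ?_ ?_ ?_ ?_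
  · nlinarith
  · nlinarith
  · linarith
  · linarith

/-- There is a constant `c0 > 0` such that for every `A > 0` there is a mixture of
Gaussian densities with variance 1 and means in `[-A, A]` having at least `c0·A²` modes. -/
theorem modes_of_bounded_gaussian_mixture_lower_bound :
    ∃ c0 : ℝ, 0 < c0 ∧ ∀ A : ℝ, 0 < A →
      ∃ (N : ℕ) (a p : Fin N → ℝ),
        1 ≤ N ∧
        (∀ k, a k ∈ Set.Icc (-A) A) ∧
        (∀ k, 0 < p k) ∧
        (∑ k, p k) = 1 ∧
        ∃ S : Finset ℝ,
          c0 * A ^ 2 ≤ (S.card : ℝ) ∧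
          ∀ x ∈ S, IsLocalMax (fun y => ∑ k, p k * stdGaussian (y - a k)) x := by
  refine ⟨1 / 10000, by norm_num, fun A hA => ?_⟩
  rcases lt_or_ge A 100 with hlt | hge
  · refine ⟨1, fun _ => 0, fun _ => 1, le_rfl, fun _ => ⟨by linarith, hA.le⟩,
      fun _ => one_pos, by simp, {0}, ?_, ?_⟩
    · simp only [Finset.card_singleton, Nat.cast_one]
      nlinarith
    · intro x hx
      rw [Finset.mem_singleton] at hx
      subst hx
      refine Filter.Eventually.of_forall (fun y => ?_)
      simp only [Finset.univ_unique, Finset.sum_singleton, one_mul, sub_zero, stdGaussian]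
      apply mul_le_mul_of_nonneg_left _ (by positivity)
      apply Real.exp_le_exp.mpr
      nlinarith [sq_nonneg y]
  · have hh : 0 < 100 / A := by positivity
    set h := 100 / A with hdef
    set K := ⌊A / h⌋₊ with hKdef
    set M := ⌊A / 2 / h⌋₊ with hMdef
    have hK1 : A < h * (K + 1) := by
      have := Nat.lt_floor_add_one (A / h)
      rw [div_lt_iff₀ hh] at this
      linarith
    have hK2 : h * K ≤ A := by
      have := Nat.floor_le (a := A / h) (by positivity)
      rw [le_div_iff₀ hh] at this
      linarith
    have hM1 : A / 2 < h * (M + 1) := by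
      have := Nat.lt_floor_add_one (A / 2 / h)
      rw [div_lt_iff₀ hh] at this
      linarith
    have hM2 : h * M ≤ A / 2 := by
      have := Nat.floor_le (a := A / 2 / h) (by positivity)
      rw [le_div_iff₀ hh] at this
      linarith
    have hex : ∀ j : ℕ, ∃ x : ℝ, j ≤ M → x ∈ Set.Ioo (h * ((j : ℝ) - 1 / 2)) (h * ((j : ℝ) + 1 / 2))
        ∧ IsLocalMax (auxG h K) x := by
      intro j
      by_cases hj : j ≤ M
      · have hjM : (j : ℝ) ≤ M := by exact_mod_cast hj
        obtain ⟨x, hx, hm⟩ := aux_main hge j K hK1 (by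
          rw [← hdef]
          exact (mul_le_mul_of_nonneg_left hjM hh.le).trans hM2)
        exact ⟨x, fun _ => ⟨hx, hm⟩⟩
      · exact ⟨0, fun h => absurd h hj⟩
    choose X hX using hex
    set I := Finset.Icc (-(K : ℤ)) K with hI
    have hcard : 0 < I.card := Finset.card_pos.mpr ⟨0, by simp [hI]⟩
    have hcard' : (0 : ℝ) < I.card := by exact_mod_cast hcard
    refine ⟨I.card, fun i => h * ((I.equivFin.symm i : ℤ) : ℝ), fun _ => 1 / (I.card : ℝ), hcard,
      fun i => ?_, fun _ => by positivity, ?_, (Finset.range (M + 1)).image X, ?_, ?_⟩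
    · have := Finset.mem_Icc.mp (I.equivFin.symm i).2
      have h1 : (-(K : ℝ)) ≤ ((I.equivFin.symm i : ℤ) : ℝ) := by exact_mod_cast this.1
      have h2 : ((I.equivFin.symm i : ℤ) : ℝ) ≤ K := by exact_mod_cast this.2
      constructor <;> nlinarith
    · simp only [Finset.sum_const, Finset.card_univ, Fintype.card_fin, nsmul_eq_mul]
      field_simp
    · rw [Finset.card_image_of_injOn, Finset.card_range]
      · push_cast
        have : h * A = 100 := by rw [hdef]; field_simp
        have h2 := mul_lt_mul_of_pos_right hM1 hA
        nlinarith
      · have hlt : ∀ m n : ℕ, m ≤ M → n ≤ M → m < n → X m < X n := by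
          intro m n hm hn hmn
          have h1 := (hX m hm).1.2
          have h2 := (hX n hn).1.1
          have h3 : (m : ℝ) + 1 ≤ n := by exact_mod_cast hmn
          nlinarith
        intro m hm n hn hmn
        simp only [Finset.coe_range, Set.mem_Iio] at hm hn
        rcases lt_trichotomy m n with hl | hl | hl
        · exact absurd hmn (hlt m n (by omega) (by omega) hl).ne
        · exact hl
        · exact absurd hmn (hlt n m (by omega) (by omega) hl).ne'
    · intro x hx
      rw [Finset.mem_image] at hx
      obtain ⟨j, hj, rfl⟩ := hx
      rw [Finset.mem_range] at hj
      have hm := (hX j (by omega)).2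
      set c := 1 / (I.card : ℝ) * (1 / Real.sqrt (2 * Real.pi)) with hc
      have hc0 : 0 ≤ c := by positivity
      have hfun : (fun y => ∑ k, 1 / (I.card : ℝ) *
          stdGaussian (y - h * ((I.equivFin.symm k : ℤ) : ℝ))) = fun y => c * auxG h K y := by
        funext y
        rw [Equiv.sum_comp I.equivFin.symm
          (fun k : I => 1 / (I.card : ℝ) * stdGaussian (y - h * ((k : ℤ) : ℝ))),
          Finset.sum_coe_sort I
          (fun k : ℤ => 1 / (I.card : ℝ) * stdGaussian (y - h * (k : ℝ)))]
        unfold auxG stdGaussian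
        rw [Finset.mul_sum]
        refine Finset.sum_congr rfl (fun k _ => ?_)
        rw [hc]
        ring
      rw [hfun]
      filter_upwards [hm] with y hy
      exact mul_le_mul_of_nonneg_left hy hc0
end

section
/- There exists a constant c# > 0 such that for every real A > 0 there exist an integer N ≥ 1, points a_1, …, a_N ∈ [−A, A], and weights p_1, …, p_N > 0 with p_1 + … + p_N = 1, satisfying the variance constraint Σ_{k=1}^N p_k·a_k² − (Σ_{k=1}^N p_k·a_k)² ≤ 1, such that the Gaussian mixture density f(x) = Σ_{k=1}^N p_k·φ(x − a_k) has at least c#·A² modes; that is, there is a finite set S ⊆ ℝ with |S| ≥ c#·A² such that f attains a local maximum at every point of S. -/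
noncomputable def gmT (s : ℝ) : ℝ := ∑' j : ℤ, Real.exp (-s * (j : ℝ) ^ 2)

lemma gm_geom (s : ℝ) (hs : 0 < s) :
    ∃ b : ℝ, HasSum (fun j : ℤ => Real.exp (-s * |(j : ℝ)|)) b ∧ b ≤ 2 * (1 + 1 / s) := by
  have hq0 : 0 ≤ Real.exp (-s) := (Real.exp_pos _).le
  have hq1 : Real.exp (-s) < 1 := by rw [Real.exp_lt_one_iff]; linarith
  have hg := hasSum_geometric_of_lt_one hq0 hq1
  have h1 : HasSum (fun n : ℕ => Real.exp (-s * |((n : ℤ) : ℝ)|)) (1 - Real.exp (-s))⁻¹ := by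
    convert hg using 2 with n
    rw [← Real.exp_nat_mul, Int.cast_natCast, abs_of_nonneg (by positivity)]
    ring_nf
  have h2 : HasSum (fun n : ℕ => Real.exp (-s * |((-((n : ℤ) + 1) : ℤ) : ℝ)|))
      (Real.exp (-s) * (1 - Real.exp (-s))⁻¹) := by
    have hg2 := hg.mul_left (Real.exp (-s))
    have hf : (fun n : ℕ => Real.exp (-s * |((-((n : ℤ) + 1) : ℤ) : ℝ)|)) =
        fun n : ℕ => Real.exp (-s) * Real.exp (-s) ^ n := by
      funext n
      rw [← Real.exp_nat_mul, ← Real.exp_add]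
      push_cast
      rw [abs_neg, abs_of_nonneg (by positivity)]
      ring_nf
    rw [hf]
    exact hg2
  refine ⟨_, HasSum.of_nat_of_neg_add_one h1 h2, ?_⟩
  have h3 : (1 - Real.exp (-s))⁻¹ ≤ 1 + 1 / s := by
    have he : Real.exp (-s) ≤ 1 / (1 + s) := by
      rw [Real.exp_neg, ← one_div]
      apply one_div_le_one_div_of_le (by linarith)
      linarith [Real.add_one_le_exp s]
    have : s / (1 + s) ≤ 1 - Real.exp (-s) := by
      have : s / (1 + s) = 1 - 1 / (1 + s) := by field_simp; ring
      linarith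
    calc (1 - Real.exp (-s))⁻¹ ≤ (s / (1 + s))⁻¹ := inv_anti₀ (by positivity) this
      _ = 1 + 1 / s := by field_simp; ring
  have h4 : 0 ≤ (1 - Real.exp (-s))⁻¹ := by
    apply inv_nonneg.mpr; linarith
  nlinarith

lemma gm_le (s : ℝ) (hs : 0 < s) (j : ℤ) :
    Real.exp (-s * (j : ℝ) ^ 2) ≤ Real.exp (-s * |(j : ℝ)|) := by
  apply Real.exp_le_exp.mpr
  have h : |(j : ℝ)| ≤ (j : ℝ) ^ 2 := by
    have : |j| ≤ j ^ 2 := by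
      rw [← sq_abs j]
      nlinarith [abs_nonneg j, Int.le_self_sq |j|]
    exact_mod_cast this
  nlinarith

lemma gm_hasSum (s : ℝ) (hs : 0 < s) :
    HasSum (fun j : ℤ => Real.exp (-s * (j : ℝ) ^ 2)) (gmT s) := by
  obtain ⟨b, hb, -⟩ := gm_geom s hs
  exact (Summable.of_nonneg_of_le (fun j => (Real.exp_pos _).le) (gm_le s hs) hb.summable).hasSum

lemma gmT_le (s : ℝ) (hs : 0 < s) : gmT s ≤ 2 * (1 + 1 / s) := by
  obtain ⟨b, hb, hle⟩ := gm_geom s hs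
  exact (hasSum_le (gm_le s hs) (gm_hasSum s hs) hb).trans hle

lemma gmT_poisson (s : ℝ) (hs : 0 < s) :
    gmT s = Real.sqrt (Real.pi / s) * gmT (Real.pi ^ 2 / s) := by
  have hpi := Real.pi_pos
  have h := Real.tsum_exp_neg_mul_int_sq (a := s / Real.pi) (by positivity)
  have e1 : -Real.pi * (s / Real.pi) = -s := by field_simp
  have e2 : -Real.pi / (s / Real.pi) = -(Real.pi ^ 2 / s) := by field_simp
  rw [e1, e2, ← Real.sqrt_eq_rpow, one_div, ← Real.sqrt_inv, inv_div] at h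
  exact h

lemma gm_odd (s : ℝ) (hs : 0 < s) :
    HasSum (fun j : ℤ => Real.exp (-s * (2 * (j : ℝ) + 1) ^ 2)) (gmT s - gmT (4 * s)) := by
  have hinj : Function.Injective (fun j : ℤ => 2 * j + 1) := fun a b h => by
    simp only at h; omega
  have hinj2 : Function.Injective (fun j : ℤ => 2 * j) := fun a b h => by
    simp only at h; omega
  have hS := gm_hasSum s hs
  have ho := (hS.summable.comp_injective hinj).hasSum
  have he := gm_hasSum (4 * s) (by linarith)
  have he' : HasSum ((fun j : ℤ => Real.exp (-s * (j : ℝ) ^ 2)) ∘ (fun j : ℤ => 2 * j))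
      (gmT (4 * s)) := by
    convert he using 2 with j
    simp only [Function.comp]
    push_cast
    ring_nf
  have hc : IsCompl (Set.range (fun j : ℤ => 2 * j)) (Set.range (fun j : ℤ => 2 * j + 1)) := by
    rw [← compl_eq_iff_isCompl]
    ext x
    simp only [Set.mem_compl_iff, Set.mem_range, not_exists]
    constructor
    · intro h
      exact ⟨x / 2, by have := h (x / 2); omega⟩
    · rintro ⟨y, rfl⟩ z
      omega
  have hall := HasSum.add_isCompl (f := fun j : ℤ => Real.exp (-s * (j : ℝ) ^ 2)) hc
    (hinj2.hasSum_range_iff.mpr he') (hinj.hasSum_range_iff.mpr ho)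
  have hu := hall.unique hS
  have : gmT s - gmT (4 * s) = ∑' b, ((fun j : ℤ => Real.exp (-s * (j : ℝ) ^ 2)) ∘
      (fun j : ℤ => 2 * j + 1)) b := by linarith
  rw [this]
  have hf : (fun j : ℤ => Real.exp (-s * (2 * (j : ℝ) + 1) ^ 2)) =
      (fun j : ℤ => Real.exp (-s * (j : ℝ) ^ 2)) ∘ (fun j : ℤ => 2 * j + 1) := by
    funext j
    simp [Function.comp]
  rw [hf]
  exact ho

lemma gm_diff (h : ℝ) (hh : 0 < h) :
    100 * (1 / h) ^ 3 * Real.exp (-80 * (1 / h) ^ 2) ≤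
      gmT (h ^ 2 / 2) - (gmT (h ^ 2 / 8) - gmT (h ^ 2 / 2)) := by
  have hpi := Real.pi_gt_three
  have hpi2 := Real.pi_lt_d2
  set u := 1 / h with hu
  have hu0 : 0 < u := by positivity
  set x := 2 * Real.pi ^ 2 * u ^ 2 with hx
  have hx0 : 0 < x := by positivity
  have p1 : gmT (h ^ 2 / 2) = Real.sqrt (2 * Real.pi) * u * gmT x := by
    rw [gmT_poisson _ (by positivity)]
    have : Real.pi / (h ^ 2 / 2) = (2 * Real.pi) * u ^ 2 := by rw [hu]; field_simp
    rw [this, Real.sqrt_mul (by positivity), Real.sqrt_sq hu0.le]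
    congr 2
    rw [hx, hu]; field_simp
  have p2 : gmT (h ^ 2 / 8) = 2 * (Real.sqrt (2 * Real.pi) * u) * gmT (4 * x) := by
    rw [gmT_poisson _ (by positivity)]
    have : Real.pi / (h ^ 2 / 8) = (2 * Real.pi) * (2 * u) ^ 2 := by rw [hu]; field_simp; ring
    rw [this, Real.sqrt_mul (by positivity), Real.sqrt_sq (by positivity)]
    have : Real.pi ^ 2 / (h ^ 2 / 8) = 4 * x := by rw [hx, hu]; field_simp; ring
    rw [this]; ring
  have hs : Real.exp (-x) - Real.exp (-(4 * x)) ≤ gmT x - gmT (4 * x) := by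
    have hd := (gm_hasSum x hx0).sub (gm_hasSum (4 * x) (by positivity))
    have := sum_le_hasSum {(1 : ℤ)} (fun i _ => by
      have : Real.exp (-(4 * x) * (i : ℝ) ^ 2) ≤ Real.exp (-x * (i : ℝ) ^ 2) := by
        apply Real.exp_le_exp.mpr
        nlinarith [sq_nonneg (i : ℝ)]
      linarith) hd
    simpa using this
  have hs2 : 3 * x * Real.exp (-(4 * x)) ≤ Real.exp (-x) - Real.exp (-(4 * x)) := by
    have : Real.exp (-x) = Real.exp (3 * x) * Real.exp (-(4 * x)) := by
      rw [← Real.exp_add]; ring_nf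
    rw [this]
    nlinarith [Real.add_one_le_exp (3 * x), Real.exp_pos (-(4 * x))]
  have hsq : 2 ≤ Real.sqrt (2 * Real.pi) := by
    apply Real.le_sqrt_of_sq_le; linarith
  have hx1 : 18 * u ^ 2 ≤ x := by
    rw [hx]
    have : 9 ≤ Real.pi ^ 2 := by nlinarith
    nlinarith [sq_nonneg u]
  have hx2 : 4 * x ≤ 80 * u ^ 2 := by
    rw [hx]
    have : Real.pi ^ 2 ≤ 10 := by nlinarith
    nlinarith [sq_nonneg u]
  have he : Real.exp (-80 * u ^ 2) ≤ Real.exp (-(4 * x)) := Real.exp_le_exp.mpr (by linarith)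
  have h5 : 54 * u ^ 2 * Real.exp (-80 * u ^ 2) ≤ gmT x - gmT (4 * x) := by
    calc 54 * u ^ 2 * Real.exp (-80 * u ^ 2) ≤ 3 * x * Real.exp (-(4 * x)) := by
          apply mul_le_mul (by linarith) he (Real.exp_pos _).le (by positivity)
      _ ≤ _ := hs2.trans hs
  rw [p1, p2]
  calc 100 * u ^ 3 * Real.exp (-80 * u ^ 2)
      ≤ (2 * 2 * u) * (54 * u ^ 2 * Real.exp (-80 * u ^ 2)) := by
        have : 0 ≤ u ^ 3 * Real.exp (-80 * u ^ 2) := by positivity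
        nlinarith
    _ ≤ (2 * Real.sqrt (2 * Real.pi) * u) * (gmT x - gmT (4 * x)) := by
        apply mul_le_mul (by nlinarith) h5 (by positivity) (by positivity)
    _ = _ := by ring

lemma gm_sum_half (h : ℝ) (hh : 0 < h) (q : ℤ) :
    HasSum (fun i : ℤ => Real.exp (-(((q : ℝ) + 1 / 2 - i) * h) ^ 2 / 2))
      (gmT (h ^ 2 / 8) - gmT (h ^ 2 / 2)) := by
  have := gm_odd (h ^ 2 / 8) (by positivity)
  rw [show 4 * (h ^ 2 / 8) = h ^ 2 / 2 by ring] at this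
  convert (Equiv.hasSum_iff (Equiv.subLeft q)).mpr this using 2 with i
  simp only [Function.comp, Equiv.subLeft_apply]
  push_cast
  ring_nf

lemma gm_sum_int (s : ℝ) (hs : 0 < s) (q : ℤ) :
    HasSum (fun i : ℤ => Real.exp (-s * ((q : ℝ) - i) ^ 2)) (gmT s) := by
  convert (Equiv.hasSum_iff (Equiv.subLeft q)).mpr (gm_hasSum s hs) using 2 with i
  simp only [Function.comp, Equiv.subLeft_apply]
  push_cast
  ring_nf

/-- numerical inequality -/
lemma gm_numeric (A u m : ℝ) (hm : 1 ≤ m) (hA : 0 < A) (h1 : 10 ^ 6 * m ≤ A ^ 2)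
    (h2 : A ^ 2 ≤ 10 ^ 6 * (m + 1)) (hu : u = 4 * m / A) :
    (8 * m + 1) * A ^ 2 * Real.exp (-(A ^ 2 / 128))
      + Real.exp (-(A ^ 2 / 16)) * (2 * (1 + 4 * u ^ 2))
      < 100 * u ^ 3 * Real.exp (-80 * u ^ 2) := by
  set t := A ^ 2 with ht
  have ht1 : (10 : ℝ) ^ 6 ≤ t := by linarith
  have hA1 : 1 ≤ A := by nlinarith
  have hu1 : u ≤ 4 * A / 10 ^ 6 := by
    rw [hu, div_le_div_iff₀ hA (by positivity)]; nlinarith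
  have hu2 : 2 * A / 10 ^ 6 ≤ u := by
    rw [hu, div_le_div_iff₀ (by positivity) hA]; nlinarith
  have hu3 : 2 / 10 ^ 6 ≤ u := by linarith
  have hu0 : 0 < u := lt_of_lt_of_le (by positivity) hu3
  have husq : u ^ 2 ≤ 16 * t / 10 ^ 12 := by
    calc u ^ 2 ≤ (4 * A / 10 ^ 6) ^ 2 := by gcongr
      _ = _ := by rw [ht]; ring
  have e1 : Real.exp (-(t / 16)) ≤ Real.exp (-(t / 128)) := Real.exp_le_exp.mpr (by linarith)
  have e2 : Real.exp (-(t / 1000)) ≤ Real.exp (-80 * u ^ 2) := Real.exp_le_exp.mpr (by linarith)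
  have e3 : Real.exp (-(t / 128)) ≤ Real.exp (-(t / 200)) * Real.exp (-(t / 1000)) := by
    rw [← Real.exp_add]; exact Real.exp_le_exp.mpr (by linarith)
  have hpos := Real.exp_pos (-(t / 128))
  have l1 : (8 * m + 1) * t * Real.exp (-(t / 128))
      + Real.exp (-(t / 16)) * (2 * (1 + 4 * u ^ 2)) ≤ 6 * t ^ 2 * Real.exp (-(t / 128)) := by
    have a1 : (8 * m + 1) * t * Real.exp (-(t / 128)) ≤ (2 * t) * t * Real.exp (-(t / 128)) := by
      gcongr; linarith
    have a2 : Real.exp (-(t / 16)) * (2 * (1 + 4 * u ^ 2)) ≤ Real.exp (-(t / 128)) * (4 * t ^ 2) := by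
      apply mul_le_mul e1 _ (by positivity) hpos.le
      nlinarith
    linarith
  have l2 : 6 * t ^ 2 < 100 * u ^ 3 * Real.exp (t / 200) := by
    have f := Real.pow_div_factorial_le_exp (x := t / 200) (by positivity) 10
    have f2 : (8 : ℝ) / 10 ^ 18 ≤ u ^ 3 := by
      calc (8 : ℝ) / 10 ^ 18 = (2 / 10 ^ 6) ^ 3 := by norm_num
        _ ≤ u ^ 3 := by gcongr
    have f3 : ((10 : ℝ) ^ 6) ^ 8 * t ^ 2 ≤ t ^ 10 := by
      calc ((10 : ℝ) ^ 6) ^ 8 * t ^ 2 ≤ t ^ 8 * t ^ 2 := by gcongr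
        _ = t ^ 10 := by ring
    have f4 : ((10 : ℝ) ^ 6) ^ 8 * t ^ 2 / (200 ^ 10 * 3628800) ≤ Real.exp (t / 200) := by
      refine le_trans ?_ f
      rw [div_pow, div_div]
      norm_num [Nat.factorial] at f3 ⊢
      linarith
    have f5 : 0 < t ^ 2 := by positivity
    calc 6 * t ^ 2 < 100 * (8 / 10 ^ 18) * (((10 : ℝ) ^ 6) ^ 8 * t ^ 2 / (200 ^ 10 * 3628800)) := by
          norm_num
          linarith
      _ ≤ _ := by gcongr
  calc _ ≤ 6 * t ^ 2 * Real.exp (-(t / 128)) := l1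
    _ ≤ 6 * t ^ 2 * (Real.exp (-(t / 200)) * Real.exp (-(t / 1000))) := by gcongr
    _ < 100 * u ^ 3 * Real.exp (t / 200) * (Real.exp (-(t / 200)) * Real.exp (-(t / 1000))) := by
        gcongr
    _ = 100 * u ^ 3 * Real.exp (-(t / 1000)) := by
        have : Real.exp (t / 200) * Real.exp (-(t / 200)) = 1 := by
          rw [← Real.exp_add]; simp
        linear_combination (100 * u ^ 3 * Real.exp (-(t / 1000))) * this
    _ ≤ _ := by gcongr

noncomputable def gmG (M h : ℝ) (m : ℕ) (x : ℝ) : ℝ :=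
  M * Real.exp (-x ^ 2 / 2) +
    ∑ i ∈ Finset.range (8 * m + 1), Real.exp (-(x - ((i : ℝ) - 4 * m) * h) ^ 2 / 2)

lemma gm_upper (h : ℝ) (hh : 0 < h) (m : ℕ) (q : ℤ) (y : ℝ) (hy : y = ((q : ℝ) + 1 / 2 - 4 * m) * h) :
    ∑ i ∈ Finset.range (8 * m + 1), Real.exp (-(y - ((i : ℝ) - 4 * m) * h) ^ 2 / 2)
      ≤ gmT (h ^ 2 / 8) - gmT (h ^ 2 / 2) := by
  have := sum_le_hasSum ((Finset.range (8 * m + 1)).map Nat.castEmbedding)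
    (fun i _ => (Real.exp_pos _).le) (gm_sum_half h hh q)
  rw [Finset.sum_map] at this
  refine le_trans (le_of_eq ?_) this
  apply Finset.sum_congr rfl
  intro i _
  simp only [Nat.castEmbedding_apply, Int.cast_natCast]
  rw [hy]
  ring_nf

lemma gm_lower (A h : ℝ) (hh : 0 < h) (m : ℕ) (hA : h * (4 * m) = A) (k : ℕ)
    (hk1 : m ≤ k) (hk2 : k ≤ 2 * m) :
    gmT (h ^ 2 / 2) - Real.exp (-(A ^ 2 / 16)) * gmT (h ^ 2 / 4) ≤
    ∑ i ∈ Finset.range (8 * m + 1), Real.exp (-(k * h - ((i : ℝ) - 4 * m) * h) ^ 2 / 2) := by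
  set F : Finset ℤ := (Finset.range (8 * m + 1)).map Nat.castEmbedding with hF
  set q : ℤ := k + 4 * m with hq
  have H1 := gm_sum_int (h ^ 2 / 2) (by positivity) q
  have H2 := (gm_sum_int (h ^ 2 / 4) (by positivity) q).mul_left (Real.exp (-(A ^ 2 / 16)))
  have H3 := hasSum_sum_of_ne_finset_zero (L := SummationFilter.unconditional ℤ)
    (f := fun i : ℤ => if i ∈ F then Real.exp (-(h ^ 2 / 2) * ((q : ℝ) - i) ^ 2) else 0) (s := F)
    (fun b hb => if_neg hb)
  have hle := hasSum_le (fun i => ?_) H1 (H3.add H2)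
  · have hs : ∑ b ∈ F, (if b ∈ F then Real.exp (-(h ^ 2 / 2) * ((q : ℝ) - b) ^ 2) else 0) =
        ∑ i ∈ Finset.range (8 * m + 1), Real.exp (-(k * h - ((i : ℝ) - 4 * m) * h) ^ 2 / 2) := by
      rw [Finset.sum_congr rfl (fun b hb => if_pos hb), hF, Finset.sum_map]
      apply Finset.sum_congr rfl
      intro i _
      simp only [Nat.castEmbedding_apply, Int.cast_natCast, hq]
      push_cast
      ring_nf
    rw [hs] at hle
    linarith
  · show Real.exp (-(h ^ 2 / 2) * ((q : ℝ) - i) ^ 2) ≤ (if i ∈ F then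
      Real.exp (-(h ^ 2 / 2) * ((q : ℝ) - i) ^ 2) else 0) + _
    split_ifs with hi
    · have : 0 ≤ Real.exp (-(A ^ 2 / 16)) * Real.exp (-(h ^ 2 / 4) * ((q : ℝ) - i) ^ 2) := by
        positivity
      linarith
    · rw [zero_add, ← Real.exp_add]
      apply Real.exp_le_exp.mpr
      have hi2 : i < 0 ∨ 8 * (m : ℤ) < i := by
        by_contra hcon
        push Not at hcon
        apply hi
        rw [hF, Finset.mem_map]
        refine ⟨i.toNat, ?_, ?_⟩
        · rw [Finset.mem_range]; omega
        · simp only [Nat.castEmbedding_apply]; omega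
      have hz : (2 * (m : ℤ)) ^ 2 ≤ (q - i) ^ 2 := by
        rcases hi2 with h' | h'
        · have : 2 * (m : ℤ) ≤ q - i := by omega
          nlinarith
        · have : 2 * (m : ℤ) ≤ i - q := by omega
          nlinarith
      have hz' : (2 * (m : ℝ)) ^ 2 ≤ ((q : ℝ) - i) ^ 2 := by exact_mod_cast hz
      have : A ^ 2 / 16 = h ^ 2 / 4 * (2 * (m : ℝ)) ^ 2 := by rw [← hA]; ring
      rw [this]
      nlinarith [mul_le_mul_of_nonneg_left hz' (by positivity : 0 ≤ h ^ 2 / 4)]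

lemma gm_key (A h : ℝ) (m : ℕ) (hm : 1 ≤ m) (hA : 0 < A) (h1 : 10 ^ 6 * (m : ℝ) ≤ A ^ 2)
    (h2 : A ^ 2 ≤ 10 ^ 6 * ((m : ℝ) + 1)) (hh : h = A / (4 * m)) (k : ℕ)
    (hk1 : m ≤ k) (hk2 : k ≤ 2 * m) (q : ℤ) (hq : (m : ℝ) - 1 ≤ q - 4 * m) (y : ℝ)
    (hy : y = ((q : ℝ) + 1 / 2 - 4 * m) * h) :
    gmG ((8 * m + 1) * A ^ 2) h m y < gmG ((8 * m + 1) * A ^ 2) h m (k * h) := by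
  have hmR : (1 : ℝ) ≤ m := by exact_mod_cast hm
  have hh0 : 0 < h := by rw [hh]; positivity
  have hhA : h * (4 * m) = A := by rw [hh]; field_simp
  have hu : 1 / h = 4 * m / A := by rw [hh]; field_simp
  have hnum := gm_numeric A (1 / h) m hmR hA h1 h2 hu
  have hd := gm_diff h hh0
  have hup := gm_upper h hh0 m q y hy
  have hlo := gm_lower A h hh0 m hhA k hk1 hk2
  have hT := gmT_le (h ^ 2 / 4) (by positivity)
  have hT2 : 2 * (1 + 1 / (h ^ 2 / 4)) = 2 * (1 + 4 * (1 / h) ^ 2) := by field_simp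
  rw [hT2] at hT
  have hT3 := mul_le_mul_of_nonneg_left hT (Real.exp_pos (-(A ^ 2 / 16))).le
  have hyA : A / 8 ≤ y := by
    rw [hy, ← hhA]
    nlinarith
  have hy2 : A ^ 2 / 64 ≤ y ^ 2 := by nlinarith
  have he : Real.exp (-y ^ 2 / 2) ≤ Real.exp (-(A ^ 2 / 128)) :=
    Real.exp_le_exp.mpr (by linarith)
  have he2 := mul_le_mul_of_nonneg_left he (by positivity : 0 ≤ (8 * (m : ℝ) + 1) * A ^ 2)
  have hpos : 0 ≤ (8 * (m : ℝ) + 1) * A ^ 2 * Real.exp (-((k : ℝ) * h) ^ 2 / 2) := by positivity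
  unfold gmG
  linarith

lemma gm_mode (f : ℝ → ℝ) (hf : Continuous f) (c r : ℝ) (hr : 0 < r)
    (h1 : f (c - r) < f c) (h2 : f (c + r) < f c) :
    ∃ x ∈ Set.Ioo (c - r) (c + r), IsLocalMax f x := by
  obtain ⟨x, hx, hmax⟩ := (isCompact_Icc (a := c - r) (b := c + r)).exists_isMaxOn
    ⟨c, by constructor <;> linarith⟩ hf.continuousOn
  have hc : f c ≤ f x := hmax (show c ∈ Set.Icc (c - r) (c + r) by constructor <;> linarith)
  have hx1 : x ≠ c - r := fun h => by rw [h] at hc; linarith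
  have hx2 : x ≠ c + r := fun h => by rw [h] at hc; linarith
  have hlt1 : c - r < x := lt_of_le_of_ne hx.1 hx1.symm
  have hlt2 : x < c + r := lt_of_le_of_ne hx.2 hx2
  exact ⟨x, ⟨hlt1, hlt2⟩, hmax.isLocalMax (Icc_mem_nhds hlt1 hlt2)⟩

lemma gm_modes (A h : ℝ) (m : ℕ) (hm : 1 ≤ m) (hA : 0 < A) (h1 : 10 ^ 6 * (m : ℝ) ≤ A ^ 2)
    (h2 : A ^ 2 ≤ 10 ^ 6 * ((m : ℝ) + 1)) (hh : h = A / (4 * m)) :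
    ∃ S : Finset ℝ, S.card = m + 1 ∧
      ∀ x ∈ S, IsLocalMax (gmG ((8 * m + 1) * A ^ 2) h m) x := by
  have hmR : (1 : ℝ) ≤ m := by exact_mod_cast hm
  have hh0 : 0 < h := by rw [hh]; positivity
  have hcont : Continuous (gmG ((8 * m + 1) * A ^ 2) h m) := by
    unfold gmG; fun_prop
  have hex : ∀ k : ℕ, ∃ x : ℝ, m ≤ k → k ≤ 2 * m →
      x ∈ Set.Ioo (k * h - h / 2) (k * h + h / 2) ∧
      IsLocalMax (gmG ((8 * m + 1) * A ^ 2) h m) x := by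
    intro k
    by_cases hk : m ≤ k ∧ k ≤ 2 * m
    · have hkR : (m : ℝ) ≤ k := by exact_mod_cast hk.1
      obtain ⟨x, hx, hl⟩ := gm_mode _ hcont (k * h) (h / 2) (by positivity)
        (gm_key A h m hm hA h1 h2 hh k hk.1 hk.2 (k + 4 * m - 1) (by push_cast; linarith) _
          (by push_cast; ring))
        (gm_key A h m hm hA h1 h2 hh k hk.1 hk.2 (k + 4 * m) (by push_cast; linarith) _
          (by push_cast; ring))
      exact ⟨x, fun _ _ => ⟨hx, hl⟩⟩
    · exact ⟨0, fun a b => absurd ⟨a, b⟩ hk⟩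
  choose x hx using hex
  refine ⟨(Finset.Icc m (2 * m)).image x, ?_, ?_⟩
  · rw [Finset.card_image_of_injOn, Nat.card_Icc]
    · omega
    · have key : ∀ i j : ℕ, i ∈ Finset.Icc m (2 * m) → j ∈ Finset.Icc m (2 * m) → i < j →
          x i < x j := by
        intro i j hi hj hij
        rw [Finset.mem_Icc] at hi hj
        have a := (hx i hi.1 hi.2).1.2
        have b := (hx j hj.1 hj.2).1.1
        have : (i : ℝ) + 1 ≤ j := by exact_mod_cast hij
        nlinarith
      intro i hi j hj hij
      rcases lt_trichotomy i j with hlt | heq | hlt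
      · exact absurd hij (key i j hi hj hlt).ne
      · exact heq
      · exact absurd hij (key j i hj hi hlt).ne'
  · intro y hy
    obtain ⟨k, hk, rfl⟩ := Finset.mem_image.mp hy
    rw [Finset.mem_Icc] at hk
    exact (hx k hk.1 hk.2).2

/-- There is a constant `c# > 0` such that for every `A > 0` there is a mixture of
Gaussian densities with variance 1 and means in `[-A, A]`, whose mixing distribution
has variance at most 1, having at least `c#·A²` modes. -/
theorem modes_of_bounded_gaussian_mixture_with_variance_constraint_lower_bound :
    ∃ cSharp : ℝ, 0 < cSharp ∧ ∀ A : ℝ, 0 < A →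
      ∃ (N : ℕ) (a p : Fin N → ℝ),
        1 ≤ N ∧
        (∀ k, a k ∈ Set.Icc (-A) A) ∧
        (∀ k, 0 < p k) ∧
        (∑ k, p k) = 1 ∧
        (∑ k, p k * (a k) ^ 2) - (∑ k, p k * a k) ^ 2 ≤ 1 ∧
        ∃ S : Finset ℝ,
          cSharp * A ^ 2 ≤ (S.card : ℝ) ∧
          ∀ x ∈ S, IsLocalMax (fun y => ∑ k, p k * stdGaussian (y - a k)) x := by
  refine ⟨1 / 10 ^ 6, by norm_num, fun A hA => ?_⟩
  have hc0 : 0 < 1 / Real.sqrt (2 * Real.pi) := by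
    have := Real.pi_pos
    positivity
  set m : ℕ := ⌊A ^ 2 / 10 ^ 6⌋₊ with hmdef
  have hm1 : (m : ℝ) ≤ A ^ 2 / 10 ^ 6 := Nat.floor_le (by positivity)
  have hm2 : A ^ 2 / 10 ^ 6 < m + 1 := Nat.lt_floor_add_one _
  rcases Nat.eq_zero_or_pos m with h0 | hpos
  · refine ⟨1, fun _ => 0, fun _ => 1, le_refl _, fun _ => ⟨by linarith, hA.le⟩,
      fun _ => one_pos, by simp, by simp, {0}, ?_, ?_⟩
    · rw [h0] at hm2
      simp only [Finset.card_singleton]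
      push_cast at hm2 ⊢
      linarith
    · intro x hx
      rw [Finset.mem_singleton] at hx
      subst hx
      refine Filter.Eventually.of_forall fun y => ?_
      simp only [Finset.univ_unique, Finset.sum_const, Finset.card_singleton, one_smul, one_mul,
        stdGaussian]
      apply mul_le_mul_of_nonneg_left _ hc0.le
      apply Real.exp_le_exp.mpr
      nlinarith [sq_nonneg y]
  · have hmR : (1 : ℝ) ≤ m := by exact_mod_cast hpos
    obtain ⟨S, hS, hmax⟩ := gm_modes A (A / (4 * m)) m hpos hA (by linarith) (by linarith) rfl
    set h := A / (4 * m) with hh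
    have hh0 : 0 < h := by rw [hh]; positivity
    have hhA : h * (4 * m) = A := by rw [hh]; field_simp
    set M : ℝ := (8 * m + 1) * A ^ 2 with hM
    set W : ℝ := M + (8 * m + 1) with hW
    have hM0 : 0 < M := by positivity
    have hW0 : 0 < W := by positivity
    have hb : ∀ i : Fin (8 * m + 1), ((i : ℝ) - 4 * m) * h ∈ Set.Icc (-A) A := by
      intro i
      have hi : ((i : ℕ) : ℝ) ≤ 8 * m := by
        have := i.isLt
        exact_mod_cast (by omega : (i : ℕ) ≤ 8 * m)
      have hi0 : (0 : ℝ) ≤ ((i : ℕ) : ℝ) := by positivity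
      rw [← hhA]
      constructor <;> nlinarith
    refine ⟨8 * m + 1 + 1, Fin.cons 0 (fun i => ((i : ℝ) - 4 * m) * h),
      Fin.cons (M / W) (fun _ => 1 / W), by omega, ?_, ?_, ?_, ?_, S, ?_, ?_⟩
    · intro k
      refine Fin.cases ?_ (fun i => ?_) k
      · simp only [Fin.cons_zero]; exact ⟨by linarith, hA.le⟩
      · simp only [Fin.cons_succ]; exact hb i
    · intro k
      refine Fin.cases ?_ (fun i => ?_) k
      · simp only [Fin.cons_zero]; positivity
      · simp only [Fin.cons_succ]; positivity
    · rw [Fin.sum_univ_succ]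
      simp only [Fin.cons_zero, Fin.cons_succ, Finset.sum_const, Finset.card_univ,
        Fintype.card_fin, nsmul_eq_mul]
      push_cast
      field_simp
      rw [hW]
    · refine le_trans (sub_le_self _ (sq_nonneg _)) ?_
      rw [Fin.sum_univ_succ]
      simp only [Fin.cons_zero, Fin.cons_succ]
      have : ∑ i : Fin (8 * m + 1), 1 / W * (((i : ℝ) - 4 * m) * h) ^ 2 ≤
          ∑ i : Fin (8 * m + 1), 1 / W * A ^ 2 := by
        apply Finset.sum_le_sum
        intro i _
        apply mul_le_mul_of_nonneg_left _ (by positivity)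
        exact sq_le_sq' (hb i).1 (hb i).2
      simp only [Finset.sum_const, Finset.card_univ, Fintype.card_fin, nsmul_eq_mul] at this
      push_cast at this
      have h3 : (8 * (m : ℝ) + 1) * (1 / W * A ^ 2) = M / W := by rw [hM]; ring
      have h4 : M / W ≤ 1 := by rw [div_le_one hW0, hW]; linarith
      rw [h3] at this
      linarith
    · rw [hS]; push_cast; linarith
    · intro x hx
      have hfun : (fun y => ∑ k, (Fin.cons (M / W) (fun _ => 1 / W) : Fin (8 * m + 1 + 1) → ℝ) k *
          stdGaussian (y - (Fin.cons 0 (fun i : Fin (8 * m + 1) => ((i : ℝ) - 4 * m) * h) :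
            Fin (8 * m + 1 + 1) → ℝ) k)) =
          fun y => (1 / Real.sqrt (2 * Real.pi) / W) * gmG M h m y := by
        funext y
        rw [Fin.sum_univ_succ]
        simp only [Fin.cons_zero, Fin.cons_succ, stdGaussian, gmG, sub_zero]
        rw [Fin.sum_univ_eq_sum_range (fun i : ℕ => 1 / W * (1 / Real.sqrt (2 * Real.pi) *
          Real.exp (-(y - ((i : ℝ) - 4 * m) * h) ^ 2 / 2))) (8 * m + 1), mul_add, Finset.mul_sum]
        congr 1
        · ring
        · apply Finset.sum_congr rfl
          intro i _
          ring
      rw [hfun]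
      have hl := hmax x hx
      filter_upwards [hl] with y hy
      exact mul_le_mul_of_nonneg_left hy (by positivity)
end

section
/- For every integer d ≥ 1 there exists a constant c_d > 0 such that for every real A > 0 there exist an integer N ≥ 1, points a_1, …, a_N ∈ [−A, A]^d, and weights p_1, …, p_N > 0 with p_1 + … + p_N = 1, such that the Gaussian mixture density f(x) = Σ_{k=1}^N p_k·φ_d(x − a_k) on ℝ^d has at least c_d·A^{2d} modes; that is, there is a finite set S ⊆ ℝ^d with |S| ≥ c_d·A^{2d} such that f attains a local maximum at every point of S. -/
/-- The standard Gaussian density on ℝ^d (zero mean, identity covariance):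
φ_d(x) = (2π)^{−d/2}·e^{−‖x‖²/2}, with `‖·‖` the Euclidean norm. -/
noncomputable def stdGaussianD (d : ℕ) (x : EuclideanSpace ℝ (Fin d)) : ℝ :=
  (2 * Real.pi) ^ (-(d : ℝ) / 2) * Real.exp (-‖x‖ ^ 2 / 2)

open Real in
lemma gm_summable (a : ℝ) (ha : 0 < a) (s : ℝ) :
    Summable (fun n : ℤ => Real.exp (-π / a * ((n : ℝ) + s) ^ 2)) := by
  have h := (summable_jacobiTheta₂_term_iff (Complex.I * (s / a : ℝ)) (Complex.I * (1 / a : ℝ))).2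
    (by simp; exact ha)
  have h2 := (h.norm).mul_left (Real.exp (-π / a * s ^ 2))
  refine h2.congr fun n => ?_
  rw [norm_jacobiTheta₂_term, ← Real.exp_add]
  congr 1
  simp
  field_simp
  ring

open Real in
lemma gm_gap (a : ℝ) (ha : 1 ≤ a) :
    (∑' n : ℤ, Real.exp (-π / a * ((n : ℝ) + 1 / 2) ^ 2)) + 2 * Real.exp (-π * a) ≤
      ∑' n : ℤ, Real.exp (-π / a * ((n : ℝ) + 0) ^ 2) := by
  have ha0 : 0 < a := by linarith
  have h1 := Real.tsum_exp_neg_mul_int_sq ha0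
  have h2 : (∑' n : ℤ, (-1 : ℝ) ^ n * Real.exp (-π * a * (n : ℝ) ^ 2)) =
      (1 : ℝ) / a ^ (1 / 2 : ℝ) * (∑' n : ℤ, Real.exp (-π / a * ((n : ℝ) + 1 / 2) ^ 2)) := by
    have h := Complex.tsum_exp_neg_quadratic (by simpa using ha0 : 0 < (a : ℂ).re) (-Complex.I / 2)
    have hb : Complex.I * (-Complex.I / 2) = 1 / 2 := by
      rw [mul_div_assoc', mul_neg, Complex.I_mul_I]; norm_num
    rw [hb] at h
    have ht : ∀ n : ℤ, Complex.exp (-π * a * (n : ℂ) ^ 2 + 2 * π * (-Complex.I / 2) * n) =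
        (((-1 : ℝ) ^ n * Real.exp (-π * a * (n : ℝ) ^ 2) : ℝ) : ℂ) := by
      intro n
      rw [Complex.exp_add]
      have : (2 * π * (-Complex.I / 2) * n : ℂ) = n * (-(π * Complex.I)) := by ring
      rw [this, Complex.exp_int_mul, Complex.exp_neg, Complex.exp_pi_mul_I]
      push_cast
      rw [mul_comm]
      norm_num
    simp_rw [ht] at h
    rw [← Complex.ofReal_inj]
    push_cast
    rw [Complex.ofReal_cpow ha0.le]
    push_cast at h ⊢
    exact h
  have hs1 : Summable (fun n : ℤ => Real.exp (-π * a * (n : ℝ) ^ 2)) := by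
    have := gm_summable (1 / a) (by positivity) 0
    refine this.congr fun n => ?_
    congr 1
    field_simp
    ring
  have hs2 : Summable (fun n : ℤ => (-1 : ℝ) ^ n * Real.exp (-π * a * (n : ℝ) ^ 2)) := by
    refine Summable.of_norm (hs1.congr fun n => ?_)
    rw [norm_mul, norm_zpow]
    simp [Real.abs_exp]
  have hd : 2 * Real.exp (-π * a) ≤ ∑' n : ℤ, (Real.exp (-π * a * (n : ℝ) ^ 2) -
      (-1 : ℝ) ^ n * Real.exp (-π * a * (n : ℝ) ^ 2)) := by
    have := (hs1.sub hs2).le_tsum (1 : ℤ) (fun n _ => by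
      have h3 : (-1 : ℝ) ^ n ≤ 1 := by
        rcases Int.even_or_odd n with h | h
        · rw [h.neg_one_zpow]
        · rw [h.neg_one_zpow]; norm_num
      have h4 := Real.exp_pos (-π * a * (n : ℝ) ^ 2)
      nlinarith)
    refine le_trans (le_of_eq ?_) this
    simp
    ring
  rw [hs1.tsum_sub hs2, h1, h2, ← mul_sub] at hd
  have hr : 1 ≤ a ^ (1 / 2 : ℝ) := Real.one_le_rpow ha (by norm_num)
  have hX : ∀ X : ℝ, 2 * Real.exp (-π * a) ≤ 1 / a ^ (1 / 2 : ℝ) * X → 2 * Real.exp (-π * a) ≤ X := by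
    intro X hX
    rw [one_div_mul_eq_div, le_div_iff₀ (by linarith)] at hX
    have := Real.exp_pos (-π * a)
    nlinarith
  have := hX _ hd
  simp only [add_zero]
  linarith

lemma gm_geom_s2 : HasSum (fun n : ℤ => (1 / 2 : ℝ) ^ n.natAbs) 3 := by
  have h := hasSum_geometric_two
  have h1 : HasSum (fun n : ℕ => (1 / 2 : ℝ) ^ ((n : ℤ)).natAbs) 2 := by simpa using h
  have h2 : HasSum (fun n : ℕ => (1 / 2 : ℝ) ^ (-((n : ℤ) + 1)).natAbs) 1 := by
    have := h.mul_left (1 / 2)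
    have he : (fun n : ℕ => (1 / 2 : ℝ) ^ (-((n : ℤ) + 1)).natAbs) =
        fun n : ℕ => 1 / 2 * (1 / 2 : ℝ) ^ n := by
      funext n
      have : (-((n : ℤ) + 1)).natAbs = n + 1 := by omega
      rw [this, pow_succ, mul_comm]
    rw [he]
    have h1 : (1 : ℝ) = 1 / 2 * 2 := by norm_num
    rw [h1]
    simpa using this
  have h3 := HasSum.of_nat_of_neg_add_one (f := fun n : ℤ => (1 / 2 : ℝ) ^ n.natAbs) h1 h2
  have h4 : (2 : ℝ) + 1 = 3 := by norm_num
  rw [h4] at h3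
  exact h3

open Real in
lemma gm_tail (K : ℕ) (hK : 1 ≤ K) (m : ℤ) (hm : 2 * (K : ℤ) ≤ |m|) :
    Real.exp (-π / K * (m : ℝ) ^ 2) ≤ Real.exp (-2 * π * K) * (1 / 2) ^ m.natAbs := by
  have hK' : (1 : ℝ) ≤ K := by exact_mod_cast hK
  have h2 : ((1 : ℝ) / 2) ^ m.natAbs ≥ Real.exp (-π * m.natAbs) := by
    rw [mul_comm, Real.exp_nat_mul]
    refine pow_le_pow_left₀ (Real.exp_pos _).le ?_ _
    have : Real.exp (-π) ≤ Real.exp (-1) := Real.exp_le_exp.2 (by linarith [Real.pi_gt_three])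
    refine this.trans ?_
    rw [Real.exp_neg, ← one_div]
    exact one_div_le_one_div_of_le (by norm_num) (by linarith [Real.exp_one_gt_d9])
  have hm' : 2 * (K : ℝ) ≤ (m.natAbs : ℝ) := by
    have : 2 * K ≤ m.natAbs := by
      rw [le_abs] at hm
      omega
    exact_mod_cast this
  have hsq : (m : ℝ) ^ 2 = (m.natAbs : ℝ) ^ 2 := by
    rw [Nat.cast_natAbs, Int.cast_abs, sq_abs]
  calc _ ≤ Real.exp (-2 * π * K) * Real.exp (-π * m.natAbs) := by
        rw [← Real.exp_add, Real.exp_le_exp, hsq, div_mul_eq_mul_div, div_le_iff₀ (by linarith)]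
        have hp := Real.pi_pos
        generalize (m.natAbs : ℝ) = M at *
        have : 2 * (K : ℝ) * K + M * K ≤ M ^ 2 := by nlinarith
        nlinarith
    _ ≤ _ := by gcongr

open Real in
lemma gm_strict (K : ℕ) (hK : 1 ≤ K) (k : ℤ) (hk : |k| ≤ 2 * K) (s : ℝ)
    (hs : s = 1 / 2 ∨ s = -(1 / 2)) :
    ∑ j ∈ Finset.Icc (-(4 * K : ℤ)) (4 * K), Real.exp (-π / K * ((k + s : ℝ) - j) ^ 2) <
    ∑ j ∈ Finset.Icc (-(4 * K : ℤ)) (4 * K), Real.exp (-π / K * ((k : ℝ) - j) ^ 2) := by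
  have hK' : (1 : ℝ) ≤ K := by exact_mod_cast hK
  have hK0 : (0 : ℝ) < K := by linarith
  have hgap := gm_gap K hK'
  have hup : ∑ j ∈ Finset.Icc (-(4 * K : ℤ)) (4 * K), Real.exp (-π / K * ((k + s : ℝ) - j) ^ 2) ≤
      ∑' n : ℤ, Real.exp (-π / K * ((n : ℝ) + 1 / 2) ^ 2) := by
    have hsum := gm_summable K hK0 (1 / 2)
    rcases hs with rfl | rfl
    · rw [← (Equiv.subLeft k).tsum_eq]
      have h2 := (Equiv.subLeft k).summable_iff.2 hsum
      refine le_trans (le_of_eq ?_) (h2.sum_le_tsum (Finset.Icc (-(4 * K : ℤ)) (4 * K)) (fun _ _ => (Real.exp_pos _).le))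
      refine Finset.sum_congr rfl fun j _ => ?_
      simp only [Function.comp, Equiv.subLeft_apply]
      push_cast
      congr 2
      ring
    · rw [← (Equiv.subRight k).tsum_eq]
      have h2 := (Equiv.subRight k).summable_iff.2 hsum
      refine le_trans (le_of_eq ?_) (h2.sum_le_tsum (Finset.Icc (-(4 * K : ℤ)) (4 * K)) (fun _ _ => (Real.exp_pos _).le))
      refine Finset.sum_congr rfl fun j _ => ?_
      simp only [Function.comp, Equiv.subRight_apply]
      push_cast
      congr 1
      ring
  have hlow : ∑' n : ℤ, Real.exp (-π / K * ((n : ℝ) + 0) ^ 2) ≤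
      ∑ j ∈ Finset.Icc (-(4 * K : ℤ)) (4 * K), Real.exp (-π / K * ((k : ℝ) - j) ^ 2)
        + Real.exp (-2 * π * K) * 3 := by
    have hsum := gm_summable K hK0 0
    rw [← (Equiv.subLeft k).tsum_eq]
    have h2 := (Equiv.subLeft k).summable_iff.2 hsum
    have h3 := ((Equiv.subLeft k).hasSum_iff.2 gm_geom_s2).mul_left (Real.exp (-2 * π * K))
    have h4 := (hasSum_sum_of_ne_finset_zero (s := Finset.Icc (-(4 * K : ℤ)) (4 * K))
      (f := fun j : ℤ => if j ∈ Finset.Icc (-(4 * K : ℤ)) (4 * K) then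
        Real.exp (-π / K * ((k : ℝ) - j) ^ 2) else 0) (fun j hj => if_neg hj)).add h3
    rw [Finset.sum_congr rfl (fun j hj => if_pos hj)] at h4
    refine hasSum_le (fun j => ?_) h2.hasSum h4
    simp only [Function.comp, Equiv.subLeft_apply]
    by_cases hj : j ∈ Finset.Icc (-(4 * K : ℤ)) (4 * K)
    · rw [if_pos hj]
      push_cast
      rw [add_zero]
      have : 0 ≤ Real.exp (-2 * π * K) * (1 / 2) ^ (k - j).natAbs := by positivity
      linarith
    · rw [if_neg hj, zero_add, add_zero]
      refine gm_tail K hK _ ?_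
      rw [Finset.mem_Icc] at hj
      rw [abs_le] at hk
      rw [le_abs]
      omega
  have hfin : Real.exp (-2 * π * K) * 3 < 2 * Real.exp (-π * K) := by
    have : Real.exp (-2 * π * K) = Real.exp (-π * K) * Real.exp (-π * K) := by
      rw [← Real.exp_add]; congr 1; ring
    have h5 : Real.exp (-π * K) ≤ 1 / 2 := by
      have : Real.exp (-π * K) ≤ Real.exp (-1) :=
        Real.exp_le_exp.2 (by nlinarith [Real.pi_gt_three])
      refine this.trans ?_
      rw [Real.exp_neg, ← one_div]
      exact one_div_le_one_div_of_le (by norm_num) (by linarith [Real.exp_one_gt_d9])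
    have := Real.exp_pos (-π * K)
    nlinarith
  linarith

lemma gm_exists_max (f : ℝ → ℝ) (hf : Continuous f) (a b c : ℝ) (hac : a < c) (hcb : c < b)
    (ha : f a < f c) (hb : f b < f c) : ∃ x ∈ Set.Ioo a b, IsLocalMax f x := by
  obtain ⟨x, hx, hm⟩ := (isCompact_Icc (a := a) (b := b)).exists_isMaxOn ⟨c, hac.le, hcb.le⟩
    hf.continuousOn
  have hc : f c ≤ f x := hm ⟨hac.le, hcb.le⟩
  have hx' : x ∈ Set.Ioo a b := by
    refine ⟨lt_of_le_of_ne hx.1 ?_, lt_of_le_of_ne hx.2 ?_⟩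
    · rintro rfl; linarith
    · rintro rfl; linarith
  exact ⟨x, hx', hm.isLocalMax (Icc_mem_nhds hx'.1 hx'.2)⟩

open Real in
lemma gm_one_dim (A : ℝ) (hA : 0 < A) : ∃ (J : Finset ℤ) (h : ℝ), J.Nonempty ∧
    (∀ j ∈ J, (j : ℝ) * h ∈ Set.Icc (-A) A) ∧
    ∃ S : Finset ℝ, 1 / (32 * π) * A ^ 2 ≤ (S.card : ℝ) ∧
      ∀ x ∈ S, IsLocalMax (fun y : ℝ => ∑ j ∈ J, Real.exp (-(y - j * h) ^ 2 / 2)) x := by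
  have hp := Real.pi_pos
  set K : ℕ := ⌊1 / (32 * π) * A ^ 2⌋₊ with hKdef
  have hKle : (K : ℝ) ≤ 1 / (32 * π) * A ^ 2 := Nat.floor_le (by positivity)
  have hKlt : 1 / (32 * π) * A ^ 2 < K + 1 := Nat.lt_floor_add_one _
  rcases Nat.eq_zero_or_pos K with h0 | hK
  · refine ⟨{0}, 0, by simp, by simp [hA.le], {0}, ?_, ?_⟩
    · rw [h0] at hKlt
      simp at hKlt ⊢
      exact hKlt.le
    · intro x hx
      rw [Finset.mem_singleton] at hx
      subst hx
      refine Filter.Eventually.of_forall fun y => ?_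
      simp only [Finset.sum_singleton, Int.cast_zero, zero_mul, sub_zero]
      refine Real.exp_le_exp.2 ?_
      nlinarith [sq_nonneg y]
  have hK' : (1 : ℝ) ≤ K := by exact_mod_cast hK
  have hK0 : (0 : ℝ) < K := by linarith
  set h : ℝ := Real.sqrt (2 * π / K) with hh
  have hpos : 0 < h := Real.sqrt_pos.2 (by positivity)
  have hsq : h ^ 2 = 2 * π / K := Real.sq_sqrt (by positivity)
  have hbd : 4 * K * h ≤ A := by
    refine abs_le_of_sq_le_sq' ?_ hA.le |>.2
    rw [mul_pow, hsq]
    rw [one_div_mul_eq_div, le_div_iff₀ (by positivity)] at hKle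
    have : (4 * (K : ℝ)) ^ 2 * (2 * π / K) = K * (32 * π) := by field_simp; ring
    rw [this]; exact hKle
  set f : ℝ → ℝ := fun y : ℝ => ∑ j ∈ Finset.Icc (-(4 * K : ℤ)) (4 * K),
    Real.exp (-(y - j * h) ^ 2 / 2) with hf
  have hfc : Continuous f := by rw [hf]; fun_prop
  have hft : ∀ t : ℝ, f (t * h) = ∑ j ∈ Finset.Icc (-(4 * K : ℤ)) (4 * K),
      Real.exp (-π / K * (t - j) ^ 2) := by
    intro t
    refine Finset.sum_congr rfl fun j _ => ?_
    congr 1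
    rw [← sub_mul, mul_pow, hsq]
    field_simp
  have hex : ∀ k : ℤ, ∃ x : ℝ, k ∈ Finset.Icc (-(2 * K : ℤ)) (2 * K) →
      x ∈ Set.Ioo (((k : ℝ) + -(1 / 2)) * h) (((k : ℝ) + 1 / 2) * h) ∧ IsLocalMax f x := by
    intro k
    by_cases hk : k ∈ Finset.Icc (-(2 * K : ℤ)) (2 * K)
    · have hk' : |k| ≤ 2 * K := by
        rw [Finset.mem_Icc] at hk
        exact abs_le.2 hk
      obtain ⟨x, hx, hm⟩ := gm_exists_max f hfc (((k : ℝ) + -(1 / 2)) * h)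
        (((k : ℝ) + 1 / 2) * h) (k * h) (by nlinarith) (by nlinarith)
        (by rw [hft, hft]; exact gm_strict K hK k hk' _ (Or.inr rfl))
        (by rw [hft, hft]; exact gm_strict K hK k hk' _ (Or.inl rfl))
      exact ⟨x, fun _ => ⟨hx, hm⟩⟩
    · exact ⟨0, fun h => absurd h hk⟩
  choose X hX using hex
  refine ⟨Finset.Icc (-(4 * K : ℤ)) (4 * K), h, ⟨0, by simp⟩, ?_,
    (Finset.Icc (-(2 * K : ℤ)) (2 * K)).image X, ?_, ?_⟩
  · intro j hj
    rw [Finset.mem_Icc] at hj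
    have h1 : -(4 * (K : ℝ)) ≤ j := by exact_mod_cast hj.1
    have h2 : (j : ℝ) ≤ 4 * K := by exact_mod_cast hj.2
    constructor <;> nlinarith
  · rw [Finset.card_image_of_injOn]
    · rw [Int.card_Icc]
      have : K + 1 ≤ (2 * (K : ℤ) + 1 - -(2 * K)).toNat := by omega
      have : ((K : ℝ) + 1) ≤ ((2 * (K : ℤ) + 1 - -(2 * K)).toNat : ℝ) := by exact_mod_cast this
      linarith
    · intro k hk l hl hkl
      have h1 := (hX k hk).1
      have h2 := (hX l hl).1
      rw [hkl] at h1
      have h3 := lt_of_mul_lt_mul_right (h1.1.trans h2.2) hpos.le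
      have h4 := lt_of_mul_lt_mul_right (h2.1.trans h1.2) hpos.le
      have h5 : k < l + 1 := by
        have : (k : ℝ) < l + 1 := by linarith
        exact_mod_cast this
      have h6 : l < k + 1 := by
        have : (l : ℝ) < k + 1 := by linarith
        exact_mod_cast this
      omega
  · intro x hx
    rw [Finset.mem_image] at hx
    obtain ⟨k, hk, rfl⟩ := hx
    exact (hX k hk).2

/-- For every `d ≥ 1` there is a constant `c_d > 0` such that for every `A > 0` there is a
mixture of standard Gaussian densities on ℝ^d with means in `[-A, A]^d` having at least
`c_d·A^{2d}` modes. -/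
theorem modes_of_bounded_gaussian_mixture_lower_bound_dim (d : ℕ) (hd : 1 ≤ d) :
    ∃ c : ℝ, 0 < c ∧ ∀ A : ℝ, 0 < A →
      ∃ (N : ℕ) (a : Fin N → EuclideanSpace ℝ (Fin d)) (p : Fin N → ℝ),
        1 ≤ N ∧
        (∀ k i, a k i ∈ Set.Icc (-A) A) ∧
        (∀ k, 0 < p k) ∧
        (∑ k, p k) = 1 ∧
        ∃ S : Finset (EuclideanSpace ℝ (Fin d)),
          c * A ^ (2 * d) ≤ (S.card : ℝ) ∧
          ∀ x ∈ S, IsLocalMax (fun y => ∑ k, p k * stdGaussianD d (y - a k)) x := by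
  have hp := Real.pi_pos
  refine ⟨(1 / (32 * Real.pi)) ^ d, by positivity, fun A hA => ?_⟩
  obtain ⟨J, h, hJ, hJA, S, hS, hmax⟩ := gm_one_dim A hA
  have : Nonempty J := hJ.to_subtype
  let e := Fintype.equivFin (Fin d → J)
  set N := Fintype.card (Fin d → J) with hN
  have hN1 : 1 ≤ N := Fintype.card_pos
  have hN0 : (0 : ℝ) < N := by exact_mod_cast hN1
  refine ⟨N, fun k => WithLp.toLp 2 (fun i => ((e.symm k i : ℤ) : ℝ) * h), fun _ => 1 / N, hN1,
    fun k i => hJA _ (e.symm k i).2, fun _ => by positivity, ?_,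
    (Fintype.piFinset (fun _ : Fin d => S)).map
      (WithLp.equiv 2 (Fin d → ℝ)).symm.toEmbedding, ?_, ?_⟩
  · rw [Finset.sum_const, Finset.card_univ, Fintype.card_fin, nsmul_eq_mul]
    field_simp
  · rw [Finset.card_map, Fintype.card_piFinset_const]
    push_cast
    rw [pow_mul, ← mul_pow]
    exact pow_le_pow_left₀ (by positivity) hS d
  · intro x hx
    rw [Finset.mem_map_equiv, Fintype.mem_piFinset] at hx
    have hfac : (fun y : EuclideanSpace ℝ (Fin d) => ∑ k : Fin N, 1 / (N : ℝ) *
        stdGaussianD d (y - WithLp.toLp 2 (fun i => ((e.symm k i : ℤ) : ℝ) * h))) =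
        fun y => (1 / (N : ℝ) * (2 * Real.pi) ^ (-(d : ℝ) / 2)) *
          ∏ i, ∑ j ∈ J, Real.exp (-(y i - j * h) ^ 2 / 2) := by
      funext y
      rw [Equiv.sum_comp e.symm (fun κ : Fin d → J => 1 / (N : ℝ) *
        stdGaussianD d (y - WithLp.toLp 2 (fun i => ((κ i : ℤ) : ℝ) * h)))]
      have : ∀ i, ∑ j ∈ J, Real.exp (-(y i - j * h) ^ 2 / 2) =
          ∑ j : J, Real.exp (-(y i - (j : ℤ) * h) ^ 2 / 2) := fun i =>
        (Finset.sum_coe_sort J (fun j : ℤ => Real.exp (-(y i - j * h) ^ 2 / 2))).symm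
      simp_rw [this]
      rw [Finset.prod_univ_sum, Fintype.piFinset_univ, Finset.mul_sum]
      refine Finset.sum_congr rfl fun κ _ => ?_
      rw [stdGaussianD, ← mul_assoc, ← Real.exp_sum, EuclideanSpace.real_norm_sq_eq,
        ← Finset.sum_div, Finset.sum_neg_distrib]
      simp
    rw [hfac]
    have hev : ∀ᶠ y : EuclideanSpace ℝ (Fin d) in nhds x, ∀ i,
        ∑ j ∈ J, Real.exp (-(y i - j * h) ^ 2 / 2) ≤
          ∑ j ∈ J, Real.exp (-(x i - j * h) ^ 2 / 2) := by
      rw [Filter.eventually_all]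
      intro i
      have hc : Filter.Tendsto (fun y : EuclideanSpace ℝ (Fin d) => y i) (nhds x) (nhds (x i)) :=
        (by fun_prop : Continuous (fun y : EuclideanSpace ℝ (Fin d) => y i)).tendsto x
      exact hc.eventually (hmax (x i) (hx i))
    filter_upwards [hev] with y hy
    refine mul_le_mul_of_nonneg_left (Finset.prod_le_prod ?_ fun i _ => hy i) (by positivity)
    intro i _
    positivity
end

section
/- For every a > 0, the quantity h_a = f_a(0) − f_a(a/2) satisfies the lower bound h_a ≥ (4/a)·e^{−2π²/a²}. -/
/-- The periodized Gaussian f_a(x) = Σ_{n∈ℤ} φ(x − a·n). -/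
noncomputable def periodizedGaussian (a : ℝ) (x : ℝ) : ℝ :=
  ∑' n : ℤ, stdGaussian (x - a * n)

lemma summable_gauss_int (c : ℝ) (hc : 0 < c) :
    Summable (fun n : ℤ => Real.exp (-c * (n : ℝ) ^ 2)) := by
  have hg : Summable (fun n : ℕ => Real.exp (-c * (n : ℝ) ^ 2)) := by
    have h1 : Summable (fun n : ℕ => Real.exp (n * (-c))) :=
      Real.summable_exp_nat_mul_iff.mpr (by linarith)
    refine Summable.of_nonneg_of_le (fun n => (Real.exp_pos _).le) (fun n => ?_) h1
    apply Real.exp_le_exp.mpr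
    have h2 : (n : ℝ) ≤ (n : ℝ) ^ 2 := by
      exact_mod_cast Nat.le_self_pow (by norm_num) n
    nlinarith
  refine Summable.of_nat_of_neg ?_ ?_
  · simpa using hg
  · simpa using hg

lemma int_even_odd_sum (g : ℤ → ℝ) (hg : Summable g) :
    ∑' n : ℤ, g n = ∑' n : ℤ, g (2 * n) + ∑' n : ℤ, g (2 * n + 1) := by
  have i1 : Function.Injective (fun n : ℤ => 2 * n) := fun x y h => by
    simp only at h; omega
  have i2 : Function.Injective (fun n : ℤ => 2 * n + 1) := fun x y h => by
    simp only at h; omega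
  have h1 := (hg.comp_injective i1).hasSum
  have h2 := (hg.comp_injective i2).hasSum
  rw [← i1.hasSum_range_iff] at h1
  rw [← i2.hasSum_range_iff] at h2
  have hc : IsCompl (Set.range (fun n : ℤ => 2 * n)) (Set.range (fun n : ℤ => 2 * n + 1)) := by
    refine compl_eq_iff_isCompl.mp ?_
    ext x
    simp only [Set.mem_compl_iff, Set.mem_range, not_exists]
    constructor
    · intro h
      exact ⟨x / 2, by have := h (x / 2); omega⟩
    · rintro ⟨y, rfl⟩ z; omega
  exact (HasSum.add_isCompl hc h1 h2).tsum_eq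

lemma poisson_gauss (a : ℝ) (ha : 0 < a) :
    ∑' n : ℤ, stdGaussian (a * n) =
      1 / a * ∑' n : ℤ, Real.exp (-(2 * Real.pi ^ 2 / a ^ 2) * (n : ℝ) ^ 2) := by
  have hpi := Real.pi_pos
  have hb : 0 < a ^ 2 / (2 * Real.pi) := by positivity
  have h := Real.tsum_exp_neg_mul_int_sq hb
  unfold stdGaussian
  rw [tsum_mul_left]
  have e1 : ∀ n : ℤ, Real.exp (-(a * n) ^ 2 / 2) =
      Real.exp (-Real.pi * (a ^ 2 / (2 * Real.pi)) * (n : ℝ) ^ 2) := by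
    intro n; congr 1; field_simp
  have e2 : ∀ n : ℤ, Real.exp (-(2 * Real.pi ^ 2 / a ^ 2) * (n : ℝ) ^ 2) =
      Real.exp (-Real.pi / (a ^ 2 / (2 * Real.pi)) * (n : ℝ) ^ 2) := by
    intro n; congr 1; field_simp
  simp_rw [e1, e2]
  rw [h, ← mul_assoc, ← Real.sqrt_eq_rpow, Real.sqrt_div (by positivity), Real.sqrt_sq ha.le]
  congr 1
  have : 0 < Real.sqrt (2 * Real.pi) := by positivity
  field_simp

/-- Lower bound of Lemma 1: h_a = f_a(0) − f_a(a/2) ≥ (4/a)·e^{−2π²/a²}. -/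
theorem ha_lower_bound (a : ℝ) (ha : 0 < a) :
    (4 / a) * Real.exp (-2 * Real.pi ^ 2 / a ^ 2) ≤
      periodizedGaussian a 0 - periodizedGaussian a (a / 2) := by
  have hpi := Real.pi_pos
  have p0 : periodizedGaussian a 0 = ∑' n : ℤ, stdGaussian (a * n) := by
    unfold periodizedGaussian stdGaussian
    simp
  have p1 : periodizedGaussian a (a / 2) =
      ∑' n : ℤ, stdGaussian (a / 2 * ((2 * n + 1 : ℤ) : ℝ)) := by
    unfold periodizedGaussian
    rw [← (Equiv.neg ℤ).tsum_eq]
    congr 1; ext n; congr 1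
    simp only [Equiv.neg_apply]; push_cast; ring
  have hs : Summable (fun n : ℤ => stdGaussian (a / 2 * (n : ℝ))) := by
    unfold stdGaussian
    refine ((summable_gauss_int (a ^ 2 / 8) (by positivity)).mul_left
      (1 / Real.sqrt (2 * Real.pi))).congr (fun n => ?_)
    congr 2; ring
  have p2 := int_even_odd_sum _ hs
  have p3 : ∑' n : ℤ, stdGaussian (a / 2 * ((2 * n : ℤ) : ℝ)) = ∑' n : ℤ, stdGaussian (a * n) := by
    congr 1; ext n; congr 1; push_cast; ring
  rw [p3, ← p1, ← p0] at p2
  rw [poisson_gauss (a / 2) (by positivity)] at p2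
  rw [poisson_gauss a ha] at p0
  have hq := summable_gauss_int (2 * Real.pi ^ 2 / a ^ 2) (by positivity)
  have q := int_even_odd_sum _ hq
  have q1 : ∑' n : ℤ, Real.exp (-(2 * Real.pi ^ 2 / (a / 2) ^ 2) * (n : ℝ) ^ 2) =
      ∑' n : ℤ, Real.exp (-(2 * Real.pi ^ 2 / a ^ 2) * ((2 * n : ℤ) : ℝ) ^ 2) := by
    congr 1; ext n; congr 1; push_cast; field_simp
  rw [q1] at p2
  have hodd : Summable (fun n : ℤ =>
      Real.exp (-(2 * Real.pi ^ 2 / a ^ 2) * ((2 * n + 1 : ℤ) : ℝ) ^ 2)) :=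
    hq.comp_injective (i := fun n : ℤ => 2 * n + 1) (fun x y h => by simp only at h; omega)
  have hl := hodd.sum_le_tsum ({0, -1} : Finset ℤ) (fun _ _ => (Real.exp_pos _).le)
  rw [Finset.sum_pair (by norm_num)] at hl
  norm_num at hl
  have e : -(2 * Real.pi ^ 2 / a ^ 2) = -2 * Real.pi ^ 2 / a ^ 2 := by ring
  push_cast at q p2
  rw [← e]
  simp only [neg_mul (2 * Real.pi ^ 2 / a ^ 2)] at p0 p2 q
  set O := ∑' n : ℤ, Real.exp (-(2 * Real.pi ^ 2 / a ^ 2 * (2 * (n : ℝ) + 1) ^ 2)) with hO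
  set E := ∑' n : ℤ, Real.exp (-(2 * Real.pi ^ 2 / a ^ 2 * (2 * (n : ℝ)) ^ 2)) with hE
  rw [q] at p0
  have key : periodizedGaussian a 0 - periodizedGaussian a (a / 2) = 2 / a * O := by
    have : periodizedGaussian a (a / 2) = 1 / (a / 2) * E - periodizedGaussian a 0 := by linarith
    rw [this, p0]; field_simp; ring
  rw [key]
  have : 4 / a * Real.exp (-(2 * Real.pi ^ 2 / a ^ 2)) =
    2 / a * (Real.exp (-(2 * Real.pi ^ 2 / a ^ 2)) + Real.exp (-(2 * Real.pi ^ 2 / a ^ 2))) := by ring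
  rw [this]
  exact mul_le_mul_of_nonneg_left hl (by positivity)
end

section
/- For every a > 0, the quantity h_a = f_a(0) − f_a(a/2) satisfies the upper bound h_a ≤ (4/a)·e^{−2π²/a²}·(1 − e^{−2π²/a²})^{−1}. -/
lemma per_eq (a : ℝ) (ha : 0 < a) (y : ℝ) :
    periodizedGaussian a (-y * a) =
      1 / a * HurwitzZeta.cosKernel (y : UnitAddCircle) (2 * Real.pi / a ^ 2) := by
  have hpi := Real.pi_pos
  have ht : 0 < a ^ 2 / (2 * Real.pi) := by positivity
  have h1 := (HurwitzZeta.hasSum_int_evenKernel y ht).tsum_eq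
  have h2 : periodizedGaussian a (-y * a) =
      (1 / Real.sqrt (2 * Real.pi)) *
        HurwitzZeta.evenKernel (y : UnitAddCircle) (a ^ 2 / (2 * Real.pi)) := by
    rw [← h1, periodizedGaussian, ← tsum_mul_left]
    refine tsum_congr fun n => ?_
    rw [stdGaussian]
    congr 2
    field_simp
    ring
  rw [h2, HurwitzZeta.evenKernel_functional_equation, ← Real.sqrt_eq_rpow,
    Real.sqrt_div (by positivity), Real.sqrt_sq ha.le, one_div_div (a ^ 2)]
  have : Real.sqrt (2 * Real.pi) ≠ 0 := by positivity
  field_simp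

lemma hasSum_bound (q : ℝ) (h0 : 0 ≤ q) (h1 : q < 1) :
    HasSum (fun n : ℤ => if n = 0 then 0 else 2 * q ^ n.natAbs) (4 * q * (1 - q)⁻¹) := by
  have hg : HasSum (fun n : ℕ => 2 * q ^ (n + 1)) (2 * q * (1 - q)⁻¹) := by
    have := (hasSum_geometric_of_lt_one h0 h1).mul_left (2 * q)
    refine this.congr_fun ?_ |> fun h => h
    intro n; ring
  have := HasSum.of_add_one_of_neg_add_one
    (f := fun n : ℤ => if n = 0 then (0 : ℝ) else 2 * q ^ n.natAbs)
    (m := 2 * q * (1 - q)⁻¹) (m' := 2 * q * (1 - q)⁻¹) ?_ ?_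
  · convert this using 1
    simp
    ring
  · convert hg using 2 with n
    rw [if_neg (by lia)]
    congr 2
  · convert hg using 2 with n
    rw [if_neg (by lia)]
    congr 2

/-- Upper bound of Lemma 1:
h_a = f_a(0) − f_a(a/2) ≤ (4/a)·e^{−2π²/a²}·(1 − e^{−2π²/a²})⁻¹. -/
theorem ha_upper_bound (a : ℝ) (ha : 0 < a) :
    periodizedGaussian a 0 - periodizedGaussian a (a / 2) ≤
      (4 / a) * Real.exp (-2 * Real.pi ^ 2 / a ^ 2) *
        (1 - Real.exp (-2 * Real.pi ^ 2 / a ^ 2))⁻¹ := by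
  have hpi := Real.pi_pos
  have e1 := per_eq a ha 0
  have e2 := per_eq a ha (-1 / 2)
  rw [show -(0 : ℝ) * a = 0 by ring] at e1
  rw [show -(-1 / 2 : ℝ) * a = a / 2 by ring] at e2
  rw [e1, e2]
  have ht : 0 < 2 * Real.pi / a ^ 2 := by positivity
  set t := 2 * Real.pi / a ^ 2 with htd
  have hqe : -2 * Real.pi ^ 2 / a ^ 2 = -Real.pi * t := by rw [htd]; ring
  rw [hqe]
  set q := Real.exp (-Real.pi * t) with hq
  have hq1 : q < 1 := by
    rw [hq, Real.exp_lt_one_iff]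
    nlinarith [mul_pos hpi ht]
  have hs := (HurwitzZeta.hasSum_int_cosKernel 0 ht).sub
    (HurwitzZeta.hasSum_int_cosKernel (-1 / 2) ht)
  have hb := hs.norm_le_of_bounded (hasSum_bound q (Real.exp_pos _).le hq1) ?_
  · rw [← Complex.ofReal_sub, Complex.norm_real, Real.norm_eq_abs] at hb
    have h3 := (le_abs_self _).trans hb
    have h4 := mul_le_mul_of_nonneg_left h3 (one_div_pos.mpr ha).le
    calc _ = _ := by ring
      _ ≤ _ := h4
      _ = _ := by ring
  · intro n
    by_cases hn : n = 0
    · simp [hn]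
    · rw [if_neg hn, ← sub_mul, norm_mul]
      refine mul_le_mul ?_ ?_ (norm_nonneg _) (by norm_num)
      · refine (norm_sub_le _ _).trans ?_
        rw [Complex.norm_exp, Complex.norm_exp]
        simp
        norm_num
      · rw [Complex.norm_real, Real.norm_eq_abs, abs_of_pos (Real.exp_pos _), hq,
          ← Real.exp_nat_mul]
        apply Real.exp_le_exp.mpr
        have h5 : (1 : ℝ) ≤ n.natAbs := by
          exact_mod_cast Nat.one_le_iff_ne_zero.mpr (Int.natAbs_ne_zero.mpr hn)
        have h6 : ((n : ℝ)) ^ 2 = (n.natAbs : ℝ) ^ 2 := by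
          rw [Nat.cast_natAbs]; push_cast; rw [sq_abs]
        rw [h6]
        nlinarith [mul_pos hpi ht, mul_nonneg (mul_pos hpi ht).le (sub_nonneg.mpr h5),
          mul_le_mul_of_nonneg_left (show (n.natAbs : ℝ) ≤ (n.natAbs : ℝ) ^ 2 by nlinarith)
            (mul_pos hpi ht).le]
end

section
/- For every a > 0, the oscillation of f_a satisfies (4/a)·e^{−2π²/a²} ≤ sup_{x∈ℝ} f_a(x) − inf_{x∈ℝ} f_a(x) ≤ (4/a)·e^{−2π²/a²}·(1 − e^{−2π²/a²})^{−1}. -/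
/-- The sum of the positive-frequency Fourier terms. -/
noncomputable def cosSeries (a x : ℝ) : ℝ :=
  ∑' k : ℕ, Real.exp (-2 * Real.pi ^ 2 / a ^ 2) ^ ((k + 1) ^ 2) *
    Real.cos (2 * Real.pi * (k + 1) * x / a)

theorem q_lt_one (a : ℝ) (ha : 0 < a) : Real.exp (-2 * Real.pi ^ 2 / a ^ 2) < 1 := by
  rw [Real.exp_lt_one_iff]
  apply div_neg_of_neg_of_pos <;> nlinarith [Real.pi_pos, pow_pos ha 2, pow_pos Real.pi_pos 2]

theorem summable_q {q : ℝ} (h0 : 0 ≤ q) (h1 : q < 1) :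
    Summable (fun k : ℕ => q ^ ((k + 1) ^ 2)) := by
  refine Summable.of_nonneg_of_le (fun k => by positivity) (fun k => ?_)
    (summable_geometric_of_lt_one h0 h1)
  exact pow_le_pow_of_le_one h0 h1.le (by nlinarith)

theorem tsum_q_le {q : ℝ} (h0 : 0 ≤ q) (h1 : q < 1) :
    ∑' k : ℕ, q ^ ((k + 1) ^ 2) ≤ q * (1 - q)⁻¹ := by
  rw [← tsum_geometric_of_lt_one h0 h1, ← tsum_mul_left]
  refine (summable_q h0 h1).tsum_le_tsum (fun k => ?_)
    ((summable_geometric_of_lt_one h0 h1).mul_left q)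
  rw [← pow_succ']
  exact pow_le_pow_of_le_one h0 h1.le (by nlinarith)

theorem norm_term_le {q : ℝ} (h0 : 0 ≤ q) (k : ℕ) (y : ℝ) :
    ‖q ^ ((k + 1) ^ 2) * Real.cos y‖ ≤ q ^ ((k + 1) ^ 2) := by
  rw [norm_mul, Real.norm_of_nonneg (by positivity : 0 ≤ q ^ ((k + 1) ^ 2))]
  exact mul_le_of_le_one_right (by positivity) (Real.abs_cos_le_one y)

theorem summable_cos (a x : ℝ) (ha : 0 < a) :
    Summable (fun k : ℕ => Real.exp (-2 * Real.pi ^ 2 / a ^ 2) ^ ((k + 1) ^ 2) *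
      Real.cos (2 * Real.pi * (k + 1) * x / a)) :=
  Summable.of_norm_bounded (summable_q (Real.exp_pos _).le (q_lt_one a ha))
    (fun k => norm_term_le (Real.exp_pos _).le k _)

theorem abs_cosSeries_le (a x : ℝ) (ha : 0 < a) :
    |cosSeries a x| ≤ Real.exp (-2 * Real.pi ^ 2 / a ^ 2) *
      (1 - Real.exp (-2 * Real.pi ^ 2 / a ^ 2))⁻¹ := by
  refine le_trans ?_ (tsum_q_le (Real.exp_pos _).le (q_lt_one a ha))
  exact tsum_of_norm_bounded (summable_q (Real.exp_pos _).le (q_lt_one a ha)).hasSum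
    (fun k => norm_term_le (Real.exp_pos _).le k _)

theorem cosSeries_diff (a : ℝ) (ha : 0 < a) :
    2 * Real.exp (-2 * Real.pi ^ 2 / a ^ 2) ≤ cosSeries a 0 - cosSeries a (a / 2) := by
  unfold cosSeries
  rw [← (summable_cos a 0 ha).tsum_sub (summable_cos a (a / 2) ha)]
  have hs := (summable_cos a 0 ha).sub (summable_cos a (a / 2) ha)
  refine le_trans (le_of_eq ?_) (hs.le_tsum 0 (fun k _ => ?_))
  · have : 2 * Real.pi * (((0 : ℕ) : ℝ) + 1) * (a / 2) / a = Real.pi := by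
      field_simp; simp
    rw [this]
    simp
    ring
  · rw [← mul_sub]
    apply mul_nonneg (by positivity)
    simp [Real.cos_le_one]

theorem term_re (a x : ℝ) (ha : 0 < a) (n : ℤ) :
    Complex.exp (-Real.pi * ((2 * Real.pi / a ^ 2 : ℝ) : ℂ) * (n : ℂ) ^ 2 +
      2 * Real.pi * (Complex.I * ((x / a : ℝ) : ℂ)) * n) =
    ((Real.exp (-2 * Real.pi ^ 2 / a ^ 2 * (n : ℝ) ^ 2) : ℝ) : ℂ) *
      Complex.exp ((2 * Real.pi * n * x / a : ℝ) * Complex.I) := by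
  rw [Complex.ofReal_exp, ← Complex.exp_add]
  congr 1
  push_cast
  ring

theorem exp_sq (c : ℝ) (k : ℕ) : Real.exp (c * ((k : ℝ) + 1) ^ 2) = Real.exp c ^ ((k + 1) ^ 2) := by
  rw [← Real.exp_nat_mul]
  push_cast
  ring_nf

theorem hasSum_term (a x : ℝ) (ha : 0 < a) :
    HasSum (fun n : ℤ => Real.exp (-2 * Real.pi ^ 2 / a ^ 2 * (n : ℝ) ^ 2) *
      Real.cos (2 * Real.pi * n * x / a)) (1 + 2 * cosSeries a x) := by
  have h := (summable_cos a x ha).hasSum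
  change HasSum _ (cosSeries a x) at h
  have := HasSum.of_add_one_of_neg_add_one (f := fun n : ℤ =>
    Real.exp (-2 * Real.pi ^ 2 / a ^ 2 * (n : ℝ) ^ 2) *
      Real.cos (2 * Real.pi * n * x / a)) (m := cosSeries a x) (m' := cosSeries a x) ?_ ?_
  · convert this using 1
    simp; ring
  · convert h using 2 with k
    push_cast
    rw [exp_sq]
  · convert h using 2 with k
    push_cast
    rw [neg_sq, exp_sq, ← Real.cos_neg]
    congr 2
    ring

theorem summable_complex (a x : ℝ) (ha : 0 < a) :
    Summable (fun n : ℤ => ((Real.exp (-2 * Real.pi ^ 2 / a ^ 2 * (n : ℝ) ^ 2) : ℝ) : ℂ) *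
      Complex.exp ((2 * Real.pi * n * x / a : ℝ) * Complex.I)) := by
  apply Summable.of_norm
  convert (hasSum_term a 0 ha).summable using 2 with n
  rw [norm_mul, Complex.norm_exp_ofReal_mul_I, Complex.norm_real,
    Real.norm_of_nonneg (Real.exp_pos _).le]
  simp

theorem periodized_eq (a x : ℝ) (ha : 0 < a) :
    periodizedGaussian a x = (1 + 2 * cosSeries a x) / a := by
  have hpi := Real.pi_pos
  have hA : 0 < 2 * Real.pi / a ^ 2 := by positivity
  have h := Complex.tsum_exp_neg_quadratic (a := ((2 * Real.pi / a ^ 2 : ℝ) : ℂ))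
    (by rwa [Complex.ofReal_re]) (Complex.I * ((x / a : ℝ) : ℂ))
  simp_rw [term_re a x ha] at h
  have h1 : ∀ n : ℤ, Complex.exp (-Real.pi / ((2 * Real.pi / a ^ 2 : ℝ) : ℂ) *
      ((n : ℂ) + Complex.I * (Complex.I * ((x / a : ℝ) : ℂ))) ^ 2) =
      ((Real.exp (-(x - a * n) ^ 2 / 2) : ℝ) : ℂ) := by
    intro n
    rw [Complex.ofReal_exp, ← mul_assoc, Complex.I_mul_I]
    congr 1
    have ha' : (a : ℂ) ≠ 0 := by exact_mod_cast ha.ne'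
    have hp' : (Real.pi : ℂ) ≠ 0 := by exact_mod_cast hpi.ne'
    push_cast
    field_simp
    ring
  simp_rw [h1] at h
  have h2 : (1 : ℂ) / ((2 * Real.pi / a ^ 2 : ℝ) : ℂ) ^ (1 / 2 : ℂ) =
      ((a / Real.sqrt (2 * Real.pi) : ℝ) : ℂ) := by
    have : (1 / 2 : ℂ) = ((1 / 2 : ℝ) : ℂ) := by push_cast; rfl
    rw [this, ← Complex.ofReal_cpow hA.le, ← Real.sqrt_eq_rpow, Real.sqrt_div (by positivity),
      Real.sqrt_sq ha.le, ← Complex.ofReal_one, ← Complex.ofReal_div, one_div_div]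
  rw [h2, ← Complex.ofReal_tsum, ← Complex.ofReal_mul] at h
  have h3 := (Complex.hasSum_re (summable_complex a x ha).hasSum)
  rw [h, Complex.ofReal_re] at h3
  have h4 := (hasSum_term a x ha)
  have h5 := h3.unique (by
    convert h4 using 2 with n
    rw [Complex.re_ofReal_mul, Complex.exp_ofReal_mul_I_re])
  unfold periodizedGaussian stdGaussian
  rw [tsum_mul_left, ← h5]
  field_simp

/-- The oscillation of f_a satisfies
(4/a)·e^{−2π²/a²} ≤ sup f_a − inf f_a ≤ (4/a)·e^{−2π²/a²}·(1 − e^{−2π²/a²})⁻¹. -/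
theorem oscillation_bounds (a : ℝ) (ha : 0 < a) :
    (4 / a) * Real.exp (-2 * Real.pi ^ 2 / a ^ 2) ≤
        (⨆ x : ℝ, periodizedGaussian a x) - (⨅ x : ℝ, periodizedGaussian a x) ∧
      (⨆ x : ℝ, periodizedGaussian a x) - (⨅ x : ℝ, periodizedGaussian a x) ≤
        (4 / a) * Real.exp (-2 * Real.pi ^ 2 / a ^ 2) *
          (1 - Real.exp (-2 * Real.pi ^ 2 / a ^ 2))⁻¹ := by
  have hu : ∀ x, periodizedGaussian a x ≤ (1 + 2 * (Real.exp (-2 * Real.pi ^ 2 / a ^ 2) *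
      (1 - Real.exp (-2 * Real.pi ^ 2 / a ^ 2))⁻¹)) / a := fun x => by
    rw [periodized_eq a x ha]
    gcongr
    exact (abs_le.1 (abs_cosSeries_le a x ha)).2
  have hl : ∀ x, (1 + 2 * -(Real.exp (-2 * Real.pi ^ 2 / a ^ 2) *
      (1 - Real.exp (-2 * Real.pi ^ 2 / a ^ 2))⁻¹)) / a ≤ periodizedGaussian a x := fun x => by
    rw [periodized_eq a x ha]
    gcongr
    exact (abs_le.1 (abs_cosSeries_le a x ha)).1
  constructor
  · have h1 := le_ciSup (f := periodizedGaussian a) ⟨_, by rintro _ ⟨x, rfl⟩; exact hu x⟩ 0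
    have h2 := ciInf_le (f := periodizedGaussian a) ⟨_, by rintro _ ⟨x, rfl⟩; exact hl x⟩ (a / 2)
    refine le_trans ?_ (sub_le_sub h1 h2)
    rw [periodized_eq a _ ha, periodized_eq a _ ha, ← sub_div, div_mul_eq_mul_div]
    gcongr
    linarith [cosSeries_diff a ha]
  · refine le_trans (sub_le_sub (ciSup_le hu) (le_ciInf hl)) (le_of_eq ?_)
    ring
end

section
/- For every a > 0 and every x ∈ ℝ that is not an integer multiple of a, one has f_a(x) < f_a(0). In particular, since f_a is periodic with period a, for every n ∈ ℤ the point n·a is a strict maximum of f_a over the interval [n·a − a/2, n·a + a/2]. -/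
lemma pg_summable (α : ℝ) (hα : 0 < α) (y : ℝ) :
    Summable (fun n : ℤ => Complex.exp (-Real.pi * (α : ℂ) * n ^ 2
      + 2 * Real.pi * (Complex.I * y) * n)) := by
  have h := (summable_jacobiTheta₂_term_iff (y : ℂ) (Complex.I * α)).2 (by simpa using hα)
  refine h.congr fun n => ?_
  unfold jacobiTheta₂_term
  congr 1
  linear_combination (-Real.pi * (α : ℂ) * n ^ 2) * (- Complex.I_sq)

lemma pg_re (α y : ℝ) (n : ℤ) :
    (Complex.exp (-Real.pi * (α : ℂ) * n ^ 2 + 2 * Real.pi * (Complex.I * y) * n)).re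
      = Real.exp (-Real.pi * α * n ^ 2) * Real.cos (2 * Real.pi * y * n) := by
  have : (-Real.pi * (α : ℂ) * n ^ 2 + 2 * Real.pi * (Complex.I * y) * n)
      = ((-Real.pi * α * n ^ 2 : ℝ) : ℂ) + ((2 * Real.pi * y * n : ℝ) : ℂ) * Complex.I := by
    push_cast; ring
  rw [this, Complex.exp_add, ← Complex.ofReal_exp, Complex.re_ofReal_mul,
    Complex.exp_ofReal_mul_I_re]

lemma pg_summable_re (α : ℝ) (hα : 0 < α) (y : ℝ) :
    Summable (fun n : ℤ => Real.exp (-Real.pi * α * n ^ 2) * Real.cos (2 * Real.pi * y * n)) :=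
  ((Complex.hasSum_re (pg_summable α hα y).hasSum).summable).congr fun n => pg_re α y n

lemma pg_poisson (α : ℝ) (hα : 0 < α) (y : ℝ) :
    ∑' n : ℤ, Real.exp (-Real.pi * α * n ^ 2) * Real.cos (2 * Real.pi * y * n)
      = 1 / α ^ (1 / 2 : ℝ) * ∑' n : ℤ, Real.exp (-Real.pi / α * (n - y) ^ 2) := by
  have h := Complex.tsum_exp_neg_quadratic (a := (α : ℂ)) (by simpa using hα) (Complex.I * y)
  have h2 : (1 / (α : ℂ) ^ (1 / 2 : ℂ) *
      ∑' n : ℤ, Complex.exp (-Real.pi / α * (n + Complex.I * (Complex.I * y)) ^ 2))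
      = ((1 / α ^ (1 / 2 : ℝ) * ∑' n : ℤ, Real.exp (-Real.pi / α * (n - y) ^ 2) : ℝ) : ℂ) := by
    rw [Complex.ofReal_mul, Complex.ofReal_tsum, Complex.ofReal_div, Complex.ofReal_cpow hα.le]
    congr 1
    · norm_num
    · refine tsum_congr fun n => ?_
      rw [← mul_assoc, Complex.I_mul_I]
      push_cast
      congr 1
      ring
  rw [h2] at h
  have h3 := congrArg Complex.re h
  rw [Complex.ofReal_re, Complex.re_tsum (pg_summable α hα y)] at h3
  rw [← h3]
  exact tsum_congr fun n => (pg_re α y n).symm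

lemma pg_eq (a : ℝ) (ha : 0 < a) (x : ℝ) :
    periodizedGaussian a x = (1 / Real.sqrt (2 * Real.pi)) *
      ∑' n : ℤ, Real.exp (-Real.pi / (2 * Real.pi / a ^ 2) * (n - x / a) ^ 2) := by
  unfold periodizedGaussian stdGaussian
  rw [tsum_mul_left]
  congr 1
  refine tsum_congr fun n => ?_
  congr 1
  have := Real.pi_ne_zero
  field_simp
  ring

lemma pg_main (a : ℝ) (ha : 0 < a) (x : ℝ) (hx : ∀ n : ℤ, x ≠ (n : ℝ) * a) :
    periodizedGaussian a x < periodizedGaussian a 0 := by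
  rw [pg_eq a ha, pg_eq a ha]
  have hp := Real.pi_pos
  have hα : 0 < 2 * Real.pi / a ^ 2 := by positivity
  generalize 2 * Real.pi / a ^ 2 = α at hα
  have hc : 0 < 1 / α ^ (1 / 2 : ℝ) := by positivity
  refine mul_lt_mul_of_pos_left ?_ (by positivity)
  refine lt_of_mul_lt_mul_left ?_ hc.le
  rw [← pg_poisson α hα, ← pg_poisson α hα]
  refine (pg_summable_re α hα _).tsum_lt_tsum (i := 1) (fun n => ?_) ?_ (pg_summable_re α hα _)
  · refine mul_le_mul_of_nonneg_left ?_ (Real.exp_pos _).le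
    simpa using Real.cos_le_one _
  · refine mul_lt_mul_of_pos_left ?_ (Real.exp_pos _)
    simp only [zero_div, mul_zero, zero_mul, Real.cos_zero]
    refine lt_of_le_of_ne (Real.cos_le_one _) fun h => ?_
    obtain ⟨k, hk⟩ := (Real.cos_eq_one_iff _).1 h
    apply hx k
    have : x / a = k := by
      push_cast at hk
      have : 2 * Real.pi * (x / a - k) = 0 := by linarith
      rcases mul_eq_zero.1 this with h | h <;> linarith
    field_simp at this
    linarith

lemma pg_periodic (a : ℝ) (n : ℤ) : periodizedGaussian a (n * a) = periodizedGaussian a 0 := by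
  unfold periodizedGaussian
  rw [← (Equiv.addRight n).tsum_eq]
  refine tsum_congr fun m => ?_
  congr 1
  simp
  ring

theorem periodizedGaussian_strict_max (a : ℝ) (ha : 0 < a) :
    (∀ x : ℝ, (∀ n : ℤ, x ≠ (n : ℝ) * a) →
        periodizedGaussian a x < periodizedGaussian a 0) ∧
      (∀ n : ℤ, ∀ x ∈ Set.Icc ((n : ℝ) * a - a / 2) ((n : ℝ) * a + a / 2),
        x ≠ (n : ℝ) * a →
          periodizedGaussian a x < periodizedGaussian a ((n : ℝ) * a)) := by
  refine ⟨pg_main a ha, fun n x hx hne => ?_⟩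
  rw [pg_periodic]
  refine pg_main a ha x fun m hm => hne ?_
  have h1 : ((m : ℝ) - n) * a ≤ 1 / 2 * a := by linarith [hx.2]
  have h2 : (-(1 / 2) : ℝ) * a ≤ ((m : ℝ) - n) * a := by linarith [hx.1]
  have h1 := le_of_mul_le_mul_right h1 ha
  have h2 := le_of_mul_le_mul_right h2 ha
  have h3 : m < n + 1 := by
    have : (m : ℝ) < n + 1 := by linarith
    exact_mod_cast this
  have h4 : n < m + 1 := by
    have : (n : ℝ) < m + 1 := by linarith
    exact_mod_cast this
  have : m = n := by omega
  rw [hm, this]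
end

section
/- Let a > 0, let n ∈ ℤ, and let I = [n·a − a/2, n·a + a/2]. If g : ℝ → ℝ is continuous and |f_a(x) − g(x)| < h_a/2 for all x ∈ I, then there exists a point x₀ in the open interval (n·a − a/2, n·a + a/2) at which g attains a local maximum. -/
theorem periodizedGaussian_shift (a x : ℝ) (m : ℤ) :
    periodizedGaussian a ((m : ℝ) * a + x) = periodizedGaussian a x := by
  unfold periodizedGaussian
  rw [← (Equiv.addRight m).tsum_eq]
  refine tsum_congr fun k => ?_
  congr 1
  simp only [Equiv.coe_addRight]
  push_cast
  ring

/-- Lemma 2 (perturbation lemma): if g is continuous and |f_a − g| < h_a/2 on the interval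
I = [n·a − a/2, n·a + a/2], where h_a = f_a(0) − f_a(a/2), then g has a local maximum at
some point of the open interval (n·a − a/2, n·a + a/2). -/
theorem perturbation_lemma (a : ℝ) (ha : 0 < a) (n : ℤ) (g : ℝ → ℝ)
    (hg : Continuous g)
    (hclose : ∀ x ∈ Set.Icc ((n : ℝ) * a - a / 2) ((n : ℝ) * a + a / 2),
      |periodizedGaussian a x - g x| <
        (periodizedGaussian a 0 - periodizedGaussian a (a / 2)) / 2) :
    ∃ x₀ ∈ Set.Ioo ((n : ℝ) * a - a / 2) ((n : ℝ) * a + a / 2), IsLocalMax g x₀ := by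
  have h0 := periodizedGaussian_shift a 0 n
  have h1 := periodizedGaussian_shift a (a / 2) n
  have h2 := periodizedGaussian_shift a (a / 2) (n - 1)
  rw [add_zero] at h0
  have e : ((n - 1 : ℤ) : ℝ) * a + a / 2 = (n : ℝ) * a - a / 2 := by push_cast; ring
  rw [e] at h2
  have c0 := abs_lt.1 (hclose ((n : ℝ) * a) ⟨by linarith, by linarith⟩)
  have c1 := abs_lt.1 (hclose ((n : ℝ) * a + a / 2) ⟨by linarith, by linarith⟩)
  have c2 := abs_lt.1 (hclose ((n : ℝ) * a - a / 2) ⟨by linarith, by linarith⟩)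
  rw [h0] at c0
  rw [h1] at c1
  rw [h2] at c2
  obtain ⟨x, hx, hmax⟩ := isCompact_Icc.exists_isMaxOn
    (⟨(n : ℝ) * a, by linarith, by linarith⟩ :
      (Set.Icc ((n : ℝ) * a - a / 2) ((n : ℝ) * a + a / 2)).Nonempty) hg.continuousOn
  have hm : g ((n : ℝ) * a) ≤ g x := hmax ⟨by linarith, by linarith⟩
  have hx1 : (n : ℝ) * a - a / 2 < x := by
    refine lt_of_le_of_ne hx.1 fun h => ?_
    rw [← h] at hm
    linarith [c0.2, c2.1]
  have hx2 : x < (n : ℝ) * a + a / 2 := by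
    refine lt_of_le_of_ne hx.2 fun h => ?_
    rw [h] at hm
    linarith [c0.2, c1.1]
  exact ⟨x, ⟨hx1, hx2⟩, hmax.isLocalMax (Icc_mem_nhds hx1 hx2)⟩
end

section
/- For every a > 0, every integer N ≥ 1, and every x ∈ ℝ with |x| ≤ aN/2, one has |f_a(x) − f_{a,N}(x)| ≤ (2/√(2π))·e^{−a²N²/8}·e^{−a²N/2}/(1 − e^{−a²N/2}). -/
/-- The truncated mixture f_{a,N}(x) = Σ_{n=−N}^{N} φ(x − a·n). -/
noncomputable def truncGaussianMix (a : ℝ) (N : ℕ) (x : ℝ) : ℝ :=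
  ∑ n ∈ Finset.Icc (-(N : ℤ)) (N : ℤ), stdGaussian (x - a * n)

theorem aux_bound (a : ℝ) (ha : 0 < a) (N j : ℕ) (x y : ℝ) (hx : |x| ≤ a * N / 2)
    (hy : |y| = (N : ℝ) + j) :
    stdGaussian (x - a * y) ≤ (1 / Real.sqrt (2 * Real.pi)) * Real.exp (-a ^ 2 * N ^ 2 / 8) *
      Real.exp (-a ^ 2 * N / 2) ^ j := by
  unfold stdGaussian
  rw [mul_assoc, ← Real.exp_nat_mul, ← Real.exp_add]
  apply mul_le_mul_of_nonneg_left _ (by positivity)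
  apply Real.exp_le_exp.mpr
  have h1 : a * ((N : ℝ) / 2 + j) ≤ |x - a * y| := by
    have h2 := abs_sub_abs_le_abs_sub (a * y) x
    rw [abs_sub_comm, abs_mul, abs_of_pos ha, hy] at h2
    nlinarith
  have h3 : (a * ((N : ℝ) / 2 + j)) ^ 2 ≤ (x - a * y) ^ 2 := by
    rw [← sq_abs (x - a * y)]
    exact pow_le_pow_left₀ (by positivity) h1 2
  nlinarith [sq_nonneg (a * (j : ℝ))]

theorem aux_sum (C r : ℝ) (hr0 : 0 ≤ r) (hr1 : r < 1) (N : ℕ) :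
    HasSum (fun n : ℤ => if n.natAbs ≤ N then (0 : ℝ) else C * r ^ (n.natAbs - N))
      (2 * (C * r / (1 - r))) := by
  have h0 : HasSum (fun k : ℕ => C * r ^ (k + 1)) (C * r / (1 - r)) := by
    have := (hasSum_geometric_of_lt_one hr0 hr1).mul_left (C * r)
    simpa [pow_succ', mul_assoc, div_eq_mul_inv] using this
  rw [two_mul]
  apply HasSum.of_nat_of_neg_add_one
  · rw [← hasSum_nat_add_iff' (N + 1), Finset.sum_eq_zero, sub_zero]
    · refine (congrArg (fun f : ℕ → ℝ => HasSum f (C * r / (1 - r))) (funext fun k => ?_)).mpr h0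
      have e : ((((k + (N + 1) : ℕ)) : ℤ)).natAbs = k + N + 1 := by omega
      rw [e, if_neg (by omega), show k + N + 1 - N = k + 1 by omega]
    · intro i hi
      have := Finset.mem_range.mp hi
      rw [if_pos (by omega)]
  · rw [← hasSum_nat_add_iff' N, Finset.sum_eq_zero, sub_zero]
    · refine (congrArg (fun f : ℕ → ℝ => HasSum f (C * r / (1 - r))) (funext fun k => ?_)).mpr h0
      have e : (-((((k + N : ℕ)) : ℤ) + 1)).natAbs = k + N + 1 := by omega
      rw [e, if_neg (by omega), show k + N + 1 - N = k + 1 by omega]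
    · intro i hi
      have := Finset.mem_range.mp hi
      rw [if_pos (by omega)]

/-- Truncation error bound: for |x| ≤ aN/2,
|f_a(x) − f_{a,N}(x)| ≤ (2/√(2π))·e^{−a²N²/8}·e^{−a²N/2}/(1 − e^{−a²N/2}). -/
theorem truncation_error_bound (a : ℝ) (ha : 0 < a) (N : ℕ) (hN : 1 ≤ N)
    (x : ℝ) (hx : |x| ≤ a * N / 2) :
    |periodizedGaussian a x - truncGaussianMix a N x| ≤
      (2 / Real.sqrt (2 * Real.pi)) * Real.exp (-a ^ 2 * N ^ 2 / 8) *
        Real.exp (-a ^ 2 * N / 2) / (1 - Real.exp (-a ^ 2 * N / 2)) := by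
  have hN' : (1 : ℝ) ≤ N := by exact_mod_cast hN
  have hr1 : Real.exp (-a ^ 2 * N / 2) < 1 := by
    rw [Real.exp_lt_one_iff]
    have : 0 < a ^ 2 * N := by positivity
    linarith
  have hB := aux_sum ((1 / Real.sqrt (2 * Real.pi)) * Real.exp (-a ^ 2 * N ^ 2 / 8))
    (Real.exp (-a ^ 2 * N / 2)) (Real.exp_pos _).le hr1 N
  set g : ℤ → ℝ := fun n => stdGaussian (x - a * n) with hg
  set p : ℤ → ℝ := fun n => if n ∈ Finset.Icc (-(N : ℤ)) (N : ℤ) then g n else 0 with hp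
  have hps : HasSum p (∑ n ∈ Finset.Icc (-(N : ℤ)) (N : ℤ), g n) := by
    have h := hasSum_sum_of_ne_finset_zero (L := .unconditional ℤ) (f := p) (s := Finset.Icc (-(N : ℤ)) (N : ℤ))
      (fun b hb => if_neg hb)
    rwa [Finset.sum_congr rfl (fun n hn => if_pos hn)] at h
  have hbd : ∀ n, ‖g n - p n‖ ≤ if n.natAbs ≤ N then (0 : ℝ) else
      (1 / Real.sqrt (2 * Real.pi)) * Real.exp (-a ^ 2 * N ^ 2 / 8) *
        Real.exp (-a ^ 2 * N / 2) ^ (n.natAbs - N) := by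
    intro n
    by_cases h : n.natAbs ≤ N
    · have : n ∈ Finset.Icc (-(N : ℤ)) (N : ℤ) := by rw [Finset.mem_Icc]; omega
      simp [hp, h, -Finset.mem_Icc, this]
    · have h' : n ∉ Finset.Icc (-(N : ℤ)) (N : ℤ) := by rw [Finset.mem_Icc]; omega
      have hpn : p n = 0 := if_neg h'
      have hgn : 0 ≤ g n := by simp only [hg, stdGaussian]; positivity
      rw [if_neg h, hpn, sub_zero, Real.norm_of_nonneg hgn]
      apply aux_bound a ha N _ x n hx
      have e : n.natAbs = N + (n.natAbs - N) := by omega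
      rw [← Int.cast_abs, ← Nat.cast_add, ← e, Int.abs_eq_natAbs, Int.cast_natCast]
  have hs : Summable (fun n => g n - p n) := Summable.of_norm_bounded hB.summable hbd
  have hgs : Summable g := by
    have := hs.add hps.summable
    simpa using this
  have key := tsum_of_norm_bounded hB hbd
  rw [hgs.tsum_sub hps.summable, hps.tsum_eq, Real.norm_eq_abs] at key
  refine key.trans (le_of_eq ?_)
  ring
end

section
/- Let N ≥ 1 be an integer and set a = 2√π/√N and C₀ = (2/√(2π))·e^{−2π}/(1 − e^{−2π}). Then for every x ∈ ℝ with |x| ≤ √(πN), one has |f_a(x) − f_{a,N}(x)| ≤ C₀·e^{−πN/2}. -/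
lemma nat_tail_aux (c q : ℝ) (hq0 : 0 ≤ q) (hq1 : q < 1) (M : ℕ) (F : ℕ → ℝ)
    (h0 : ∀ i < M, F i = 0) (h1 : ∀ k, F (k + M) = c * q ^ (k + 1)) :
    HasSum F (c * (q / (1 - q))) := by
  rw [← hasSum_nat_add_iff' M]
  have hz : ∑ i ∈ Finset.range M, F i = 0 :=
    Finset.sum_eq_zero fun i hi => h0 i (Finset.mem_range.mp hi)
  rw [hz, sub_zero]
  have := ((hasSum_geometric_of_lt_one hq0 hq1).mul_left q).mul_left c
  simp_rw [h1, pow_succ']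
  simpa [div_eq_mul_inv] using this

lemma int_tail_aux (c q : ℝ) (hq0 : 0 ≤ q) (hq1 : q < 1) (N : ℕ) :
    HasSum (fun n : ℤ => if n.natAbs ≤ N then 0 else c * q ^ (n.natAbs - N))
      (c * (q / (1 - q)) + c * (q / (1 - q))) := by
  apply HasSum.of_nat_of_neg_add_one
  · apply nat_tail_aux c q hq0 hq1 (N + 1)
    · intro i hi
      have : ((i : ℤ)).natAbs ≤ N := by omega
      exact if_pos this
    · intro k
      have h : ¬ (((k + (N + 1) : ℕ) : ℤ)).natAbs ≤ N := by omega
      have h' : (((k + (N + 1) : ℕ) : ℤ)).natAbs - N = k + 1 := by omega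
      rw [if_neg h, h']
  · apply nat_tail_aux c q hq0 hq1 N
    · intro i hi
      have : (-((i : ℤ) + 1)).natAbs ≤ N := by omega
      exact if_pos this
    · intro k
      have h : ¬ (-(((k + N : ℕ) : ℤ) + 1)).natAbs ≤ N := by omega
      have h' : (-(((k + N : ℕ) : ℤ) + 1)).natAbs - N = k + 1 := by omega
      rw [if_neg h, h']

lemma term_aux (N : ℕ) (hN : 1 ≤ N) (a x : ℝ)
    (ha : a = 2 * Real.sqrt Real.pi / Real.sqrt N)
    (hx : |x| ≤ Real.sqrt (Real.pi * N)) (n : ℤ) (hn : ¬ n.natAbs ≤ N) :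
    stdGaussian (x - a * n) ≤
      (1 / Real.sqrt (2 * Real.pi) * Real.exp (-Real.pi * N / 2)) *
        Real.exp (-2 * Real.pi) ^ (n.natAbs - N) := by
  obtain ⟨k, hk⟩ : ∃ k : ℕ, n.natAbs = N + k := ⟨n.natAbs - N, by omega⟩
  have hN0 : (0 : ℝ) < N := by exact_mod_cast hN
  have hpi := Real.pi_pos
  have hsN : 0 < Real.sqrt N := Real.sqrt_pos.mpr hN0
  have ha0 : 0 < a := by rw [ha]; positivity
  have ha2 : a ^ 2 * N = 4 * Real.pi := by
    rw [ha, div_pow, mul_pow, Real.sq_sqrt hpi.le, Real.sq_sqrt hN0.le]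
    field_simp; norm_num
  have hs : Real.sqrt (Real.pi * N) = a * N / 2 := by
    rw [Real.sqrt_eq_iff_mul_self_eq (by positivity) (by positivity)]
    nlinarith
  rw [hs] at hx
  have habs : |(n : ℝ)| = N + k := by
    rw [← Int.cast_abs, Int.abs_eq_natAbs, hk]; push_cast; ring
  have hlow : a * N / 2 + a * k ≤ |x - a * n| := by
    have h1 := abs_sub_abs_le_abs_sub (a * (n : ℝ)) x
    rw [abs_mul, abs_of_pos ha0, habs, abs_sub_comm] at h1
    linarith
  have hsq : (a * N / 2 + a * k) ^ 2 ≤ (x - a * n) ^ 2 := by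
    rw [← sq_abs (x - a * n)]
    exact pow_le_pow_left₀ (by positivity) hlow 2
  have hexp : (a * N / 2 + a * k) ^ 2
      = Real.pi * N + 4 * Real.pi * k + (a * k) ^ 2 := by
    linear_combination (N / 4 + k : ℝ) * ha2
  have hk' : n.natAbs - N = k := by omega
  rw [hk', ← Real.exp_nat_mul, mul_assoc, ← Real.exp_add]
  unfold stdGaussian
  apply mul_le_mul_of_nonneg_left _ (by positivity)
  apply Real.exp_le_exp.mpr
  nlinarith [sq_nonneg (a * k)]

/-- With a = 2√π/√N and C₀ = (2/√(2π))·e^{−2π}/(1 − e^{−2π}), one has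
|f_a(x) − f_{a,N}(x)| ≤ C₀·e^{−πN/2} for all |x| ≤ √(πN). -/
theorem truncation_error_bound_specific (N : ℕ) (hN : 1 ≤ N) (a C₀ : ℝ)
    (ha : a = 2 * Real.sqrt Real.pi / Real.sqrt N)
    (hC₀ : C₀ = (2 / Real.sqrt (2 * Real.pi)) * Real.exp (-2 * Real.pi) /
      (1 - Real.exp (-2 * Real.pi)))
    (x : ℝ) (hx : |x| ≤ Real.sqrt (Real.pi * N)) :
    |periodizedGaussian a x - truncGaussianMix a N x| ≤
      C₀ * Real.exp (-Real.pi * N / 2) := by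
  set c : ℝ := 1 / Real.sqrt (2 * Real.pi) * Real.exp (-Real.pi * N / 2) with hc
  set q : ℝ := Real.exp (-2 * Real.pi) with hq
  have hq0 : 0 ≤ q := (Real.exp_pos _).le
  have hq1 : q < 1 := by
    rw [hq, Real.exp_lt_one_iff]; linarith [Real.pi_pos]
  have hB := int_tail_aux c q hq0 hq1 N
  set g : ℤ → ℝ := fun n => stdGaussian (x - a * n) with hg
  have hg0 : ∀ n, 0 ≤ g n := fun n => by simp only [hg, stdGaussian]; positivity
  set h : ℤ → ℝ := fun n => if n.natAbs ≤ N then 0 else g n with hh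
  have hh0 : ∀ n, 0 ≤ h n := fun n => by
    simp only [hh]; split_ifs
    · exact le_rfl
    · exact hg0 n
  have hle : ∀ n, h n ≤ (if n.natAbs ≤ N then 0 else c * q ^ (n.natAbs - N)) := fun n => by
    simp only [hh]; split_ifs with hn
    · exact le_rfl
    · exact term_aux N hN a x ha hx n hn
  have hs : Summable h := Summable.of_nonneg_of_le hh0 hle hB.summable
  have htop : ∑' n, h n ≤ c * (q / (1 - q)) + c * (q / (1 - q)) :=
    hasSum_le hle hs.hasSum hB
  have hfin : HasSum (fun n => g n - h n)
      (∑ n ∈ Finset.Icc (-(N : ℤ)) (N : ℤ), (g n - h n)) := by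
    apply hasSum_sum_of_ne_finset_zero
    intro n hn
    have : ¬ n.natAbs ≤ N := by
      intro h'; apply hn; rw [Finset.mem_Icc]; omega
    simp [hh, this]
  have hfin' : ∑ n ∈ Finset.Icc (-(N : ℤ)) (N : ℤ), (g n - h n) = truncGaussianMix a N x := by
    unfold truncGaussianMix
    apply Finset.sum_congr rfl
    intro n hn
    rw [Finset.mem_Icc] at hn
    have : n.natAbs ≤ N := by omega
    simp [hh, this, hg]
  rw [hfin'] at hfin
  have htot : HasSum g (truncGaussianMix a N x + ∑' n, h n) := by
    have := hfin.add hs.hasSum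
    simpa using this
  have heq : periodizedGaussian a x = truncGaussianMix a N x + ∑' n, h n := htot.tsum_eq
  rw [heq, add_sub_cancel_left, abs_of_nonneg (tsum_nonneg hh0)]
  refine htop.trans (le_of_eq ?_)
  rw [hC₀, hc]; ring
end

section
/- Let N ≥ 1 be an integer, set a = 2√π/√N and C₀ = (2/√(2π))·e^{−2π}/(1 − e^{−2π}). Then for every x ∈ [3√(πN), 5√(πN)], one has Σ_{n∈ℤ: n < N or n > 3N} φ(x − a·n) ≤ C₀·e^{−πN/2}. -/
theorem tail_term_bound (s a : ℝ) (P t : ℝ) (k : ℕ) (hs : 0 ≤ s) (ha : 0 ≤ a)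
    (hs2 : s ^ 2 = P) (has : a * s = 2 * Real.pi)
    (ht : s + a * (k + 1) ≤ |t|) :
    stdGaussian t ≤ (1 / Real.sqrt (2 * Real.pi)) * (Real.exp (-P / 2) *
      Real.exp (-2 * Real.pi)) * Real.exp (-2 * Real.pi) ^ k := by
  unfold stdGaussian
  rw [mul_assoc, mul_assoc, ← Real.exp_nat_mul, ← Real.exp_add, ← Real.exp_add]
  apply mul_le_mul_of_nonneg_left _ (by positivity)
  apply Real.exp_le_exp.2
  have h1 : (s + a * (k + 1)) ^ 2 ≤ t ^ 2 := by
    rw [← sq_abs t]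
    exact pow_le_pow_left₀ (by positivity) ht 2
  have h2 : (s + a * (k + 1)) ^ 2 = P + 4 * Real.pi * (k + 1) + (a * (k + 1)) ^ 2 := by
    linear_combination hs2 + 2 * (k + 1 : ℝ) * has
  have h3 := sq_nonneg (a * ((k : ℝ) + 1))
  linarith

/-- The tail index set is two copies of the natural numbers. -/
def tailEquiv (N : ℕ) : ℕ ⊕ ℕ ≃ {n : ℤ // n < (N : ℤ) ∨ 3 * (N : ℤ) < n} where
  toFun := Sum.elim (fun k => ⟨(N : ℤ) - 1 - k, by omega⟩) (fun k => ⟨3 * (N : ℤ) + 1 + k, by omega⟩)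
  invFun n := if (n : ℤ) < N then Sum.inl ((N : ℤ) - 1 - n).toNat
    else Sum.inr ((n : ℤ) - 3 * N - 1).toNat
  left_inv := by
    rintro (k | k)
    · have : (N : ℤ) - 1 - k < N := by omega
      simp [this]
    · have : ¬ (3 * (N : ℤ) + 1 + k < N) := by omega
      simp only [Sum.elim_inr, this, if_false]
      congr 1
      omega
  right_inv := by
    rintro ⟨n, hn⟩
    by_cases h : n < (N : ℤ)
    · simp only [h, if_true, Sum.elim_inl, Subtype.mk.injEq]
      omega
    · simp only [h, if_false, Sum.elim_inr, Subtype.mk.injEq]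
      omega

/-- With a = 2√π/√N and C₀ = (2/√(2π))·e^{−2π}/(1 − e^{−2π}), for every
x ∈ [3√(πN), 5√(πN)] one has Σ_{n < N or n > 3N} φ(x − a·n) ≤ C₀·e^{−πN/2}. -/
theorem tail_sum_bound (N : ℕ) (hN : 1 ≤ N) (a C₀ : ℝ)
    (ha : a = 2 * Real.sqrt Real.pi / Real.sqrt N)
    (hC₀ : C₀ = (2 / Real.sqrt (2 * Real.pi)) * Real.exp (-2 * Real.pi) /
      (1 - Real.exp (-2 * Real.pi)))
    (x : ℝ)
    (hx : x ∈ Set.Icc (3 * Real.sqrt (Real.pi * N)) (5 * Real.sqrt (Real.pi * N))) :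
    (∑' n : {n : ℤ // n < (N : ℤ) ∨ 3 * (N : ℤ) < n},
        stdGaussian (x - a * ((n : ℤ) : ℝ))) ≤
      C₀ * Real.exp (-Real.pi * N / 2) := by
  have hpi := Real.pi_pos
  have hN0 : (0 : ℝ) < N := by exact_mod_cast hN
  have hsN : 0 < Real.sqrt N := Real.sqrt_pos.2 hN0
  have hsN2 : Real.sqrt N ^ 2 = N := Real.sq_sqrt hN0.le
  have hspi2 : Real.sqrt Real.pi ^ 2 = Real.pi := Real.sq_sqrt hpi.le
  have hsm : Real.sqrt (Real.pi * N) = Real.sqrt Real.pi * Real.sqrt N := Real.sqrt_mul hpi.le _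
  have has : a * Real.sqrt (Real.pi * N) = 2 * Real.pi := by
    rw [ha, hsm]; field_simp; linarith
  have haN : a * N = 2 * Real.sqrt (Real.pi * N) := by
    rw [ha, hsm, div_mul_eq_mul_div, div_eq_iff hsN.ne']
    linear_combination (-2 * Real.sqrt Real.pi) * hsN2
  have ha0 : 0 ≤ a := by rw [ha]; positivity
  have hs2 : Real.sqrt (Real.pi * N) ^ 2 = Real.pi * N := Real.sq_sqrt (by positivity)
  have hs0 := Real.sqrt_nonneg (Real.pi * N)
  generalize Real.sqrt (Real.pi * N) = s at *
  obtain ⟨hx1, hx2⟩ := hx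
  have hr1 : Real.exp (-2 * Real.pi) < 1 := Real.exp_lt_one_iff.mpr (by linarith)
  set c := (1 / Real.sqrt (2 * Real.pi)) * (Real.exp (-(Real.pi * N) / 2) *
      Real.exp (-2 * Real.pi)) with hc
  have hg := (hasSum_geometric_of_lt_one (Real.exp_pos _).le hr1).mul_left c
  have hG : HasSum (Sum.elim (fun k : ℕ => c * Real.exp (-2 * Real.pi) ^ k)
      (fun k : ℕ => c * Real.exp (-2 * Real.pi) ^ k)) _ := HasSum.sum (f := Sum.elim _ _) hg hg
  rw [← (tailEquiv N).tsum_eq]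
  have hle : ∀ k : ℕ ⊕ ℕ, stdGaussian (x - a * (((tailEquiv N k : _) : ℤ) : ℝ)) ≤
      Sum.elim (fun k : ℕ => c * Real.exp (-2 * Real.pi) ^ k)
      (fun k : ℕ => c * Real.exp (-2 * Real.pi) ^ k) k := by
    rintro (k | k)
    · refine tail_term_bound s a _ _ k hs0 ha0 hs2 has (le_trans ?_ (le_abs_self _))
      simp only [tailEquiv, Equiv.coe_fn_mk, Sum.elim_inl]
      push_cast
      linarith
    · refine tail_term_bound s a _ _ k hs0 ha0 hs2 has (le_trans ?_ (neg_le_abs _))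
      simp only [tailEquiv, Equiv.coe_fn_mk, Sum.elim_inr]
      push_cast
      linarith
  have hf := Summable.of_nonneg_of_le (fun k => by unfold stdGaussian; positivity) hle hG.summable
  refine (hasSum_le hle hf.hasSum hG).trans (le_of_eq ?_)
  rw [hC₀, hc, neg_mul Real.pi]
  ring
end

section
/- There exists an integer N₀ such that for every integer N ≥ N₀ the following holds: with a = 2√π/√N and α = 1/(12π(3N+1)), the Gaussian mixture density Γ(x) = (1 − 2α)·φ(x) + (α/(2N+1))·Σ_{n=N}^{3N} (φ(x + a·n) + φ(x − a·n)) has at least N − 1 distinct local maximum points in the interval [3√(πN), 5√(πN)] (and, by symmetry, at least N − 1 distinct local maximum points in [−5√(πN), −3√(πN)]). -/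
/-- The mixture Γ(x) = (1 − 2α)·φ(x) + (α/(2N+1))·Σ_{n=N}^{3N} (φ(x + a·n) + φ(x − a·n)). -/
noncomputable def GammaMix (N : ℕ) (a α : ℝ) (x : ℝ) : ℝ :=
  (1 - 2 * α) * stdGaussian x +
    (α / (2 * (N : ℝ) + 1)) *
      ∑ n ∈ Finset.Icc N (3 * N),
        (stdGaussian (x + a * (n : ℝ)) + stdGaussian (x - a * (n : ℝ)))

namespace GM
open Real

lemma summ (c : ℝ) (hc : 0 < c) : Summable (fun n : ℤ => exp (-c * (n:ℝ)^2)) := by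
  have := summable_pow_mul_jacobiTheta₂_term_bound 0 (T := c / π) (by positivity) 0
  refine this.congr (fun n => ?_)
  simp only [pow_zero, one_mul]
  congr 1
  field_simp
  ring

lemma inj_even : Function.Injective (fun n : ℤ => 2 * n) := fun a b h => by
  simp only at h; omega
lemma inj_odd : Function.Injective (fun n : ℤ => 2 * n + 1) := fun a b h => by
  simp only at h; omega

lemma tsum_split (f : ℤ → ℝ) (hf : Summable f) :
    ∑' n, f n = ∑' n, f (2 * n) + ∑' n, f (2 * n + 1) := by
  have he := (hf.comp_injective inj_even).hasSum
  have ho := (hf.comp_injective inj_odd).hasSum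
  have he' := inj_even.hasSum_range_iff.2 he
  have ho' := inj_odd.hasSum_range_iff.2 ho
  refine (HasSum.add_isCompl ?_ he' ho').tsum_eq
  rw [isCompl_iff, Set.disjoint_left, codisjoint_iff]
  constructor
  · rintro _ ⟨a, rfl⟩ ⟨b, hb⟩
    simp only at hb; omega
  · ext x
    simp only [Set.sup_eq_union, Set.mem_union, Set.mem_range, Set.top_eq_univ, Set.mem_univ,
      iff_true]
    rcases Int.even_or_odd' x with ⟨k, h | h⟩
    · exact Or.inl ⟨k, h.symm⟩
    · exact Or.inr ⟨k, h.symm⟩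

/-- integer theta sum -/
noncomputable def T0 (N : ℕ) : ℝ := ∑' n : ℤ, exp (-(2 * π / N) * (n:ℝ)^2)
/-- half-integer theta sum -/
noncomputable def T1 (N : ℕ) : ℝ := ∑' n : ℤ, exp (-(2 * π / N) * ((n:ℝ) + 1/2)^2)

lemma summ1 (N : ℕ) (hN : 0 < N) :
    Summable (fun n : ℤ => exp (-(2 * π / N) * ((n:ℝ) + 1/2)^2)) := by
  have hN' : (0:ℝ) < N := by exact_mod_cast hN
  refine ((summ (π / (2 * N)) (by positivity)).comp_injective inj_odd).congr (fun n => ?_)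
  simp only [Function.comp]
  congr 1
  push_cast
  field_simp

lemma T_add (N : ℕ) (hN : 0 < N) :
    T0 N + T1 N = ∑' n : ℤ, exp (-(π / (2 * N)) * (n:ℝ)^2) := by
  have hN' : (0:ℝ) < N := by exact_mod_cast hN
  rw [tsum_split _ (summ (π / (2 * N)) (by positivity)), T0, T1]
  congr 1 <;> refine tsum_congr (fun n => ?_) <;> congr 1 <;> push_cast <;> field_simp

lemma T_diff (N : ℕ) (hN : 0 < N) :
    √(2 * N) * exp (-(π * N / 2)) ≤ T0 N - T1 N := by
  have hN' : (0:ℝ) < N := by exact_mod_cast hN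
  have h2 := T_add N hN
  have e0 : T0 N = √(2 * N) / 2 * ∑' n : ℤ, exp (-(π * N / 2) * (n:ℝ)^2) := by
    have := Real.tsum_exp_neg_mul_int_sq (a := 2 / N) (by positivity)
    rw [← Real.sqrt_eq_rpow] at this
    have h3 : 1 / √(2 / (N:ℝ)) = √(2 * N) / 2 := by
      have : (2:ℝ) / N = 2 * (2 * N) / (N * (2 * N)) := by field_simp
      rw [div_eq_div_iff (by positivity) (by positivity), ← Real.sqrt_mul (by positivity)]
      rw [show 2 * (N:ℝ) * (2 / N) = 2 ^ 2 by field_simp]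
      rw [Real.sqrt_sq (by norm_num)]; ring
    rw [h3] at this
    unfold T0
    convert this using 1
    · refine tsum_congr (fun n => ?_); congr 1; field_simp
    · congr 1; refine tsum_congr (fun n => ?_); congr 1; field_simp
  have e1 : ∑' n : ℤ, exp (-(π / (2 * N)) * (n:ℝ)^2)
      = √(2 * N) * ∑' n : ℤ, exp (-(π * N / 2) * ((2 * n : ℤ):ℝ)^2) := by
    have := Real.tsum_exp_neg_mul_int_sq (a := 1 / (2 * N)) (by positivity)
    rw [← Real.sqrt_eq_rpow] at this
    have h3 : 1 / √(1 / (2 * (N:ℝ))) = √(2 * N) := by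
      rw [Real.sqrt_div (by norm_num)]; simp
    rw [h3] at this
    convert this using 1
    · refine tsum_congr (fun n => ?_); congr 1; field_simp
    · congr 1; refine tsum_congr (fun n => ?_); congr 1; push_cast; field_simp
  have hs := summ (π * N / 2) (by positivity)
  have e2 := tsum_split _ hs
  have e3 : exp (-(π * N / 2)) ≤ ∑' n : ℤ, exp (-(π * N / 2) * ((2 * n + 1 : ℤ):ℝ)^2) := by
    have := (hs.comp_injective inj_odd).le_tsum 0 (fun _ _ => (exp_pos _).le)
    simpa using this
  have hq : 0 ≤ √(2 * (N:ℝ)) := Real.sqrt_nonneg _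
  have := mul_le_mul_of_nonneg_left e3 hq
  have e5 : T0 N - T1 N = 2 * T0 N - (T0 N + T1 N) := by ring
  rw [e5, h2, e1, e0, e2]
  linarith

lemma tail (N k : ℕ) (hN : 0 < N) (hk : N ≤ 2 * k) :
    ∑' i : ℕ, exp (-(2 * π / N) * ((i:ℝ) + k)^2) ≤ 2 * exp (-(π * N / 2)) := by
  have hN' : (0:ℝ) < N := by exact_mod_cast hN
  have hk' : (N:ℝ) ≤ 2 * k := by exact_mod_cast hk
  have hb : ∀ i : ℕ, exp (-(2 * π / N) * ((i:ℝ) + k)^2)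
      ≤ exp (-(π * N / 2)) * (1/2 : ℝ) ^ i := by
    intro i
    have h1 : (1/2:ℝ)^i = exp (-(i * log 2)) := by
      rw [Real.exp_neg, Real.exp_nat_mul, Real.exp_log (by norm_num)]; simp
    rw [h1, ← Real.exp_add]
    apply Real.exp_le_exp.2
    have hi : (0:ℝ) ≤ i := Nat.cast_nonneg i
    have hl : log 2 ≤ 2 * π := by linarith [Real.log_two_lt_d9, Real.pi_gt_three]
    have : π * N / 2 + i * (2 * π) ≤ (2 * π / N) * ((i:ℝ) + k)^2 := by
      have h2 : (N:ℝ)^2 / 4 + N * i ≤ ((i:ℝ) + k)^2 := by nlinarith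
      calc π * N / 2 + i * (2 * π) = (2 * π / N) * ((N:ℝ)^2 / 4 + N * i) := by field_simp; ring
        _ ≤ _ := by gcongr
    have := mul_le_mul_of_nonneg_left hl hi
    linarith
  have hg : Summable (fun i : ℕ => exp (-(π * N / 2)) * (1/2 : ℝ) ^ i) :=
    (summable_geometric_two).mul_left _
  have hs : Summable (fun i : ℕ => exp (-(2 * π / N) * ((i:ℝ) + k)^2)) :=
    Summable.of_nonneg_of_le (fun _ => (exp_pos _).le) hb hg
  refine (hs.tsum_le_tsum hb hg).trans ?_
  rw [tsum_mul_left, tsum_geometric_two]; linarith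

lemma fin_lower (N m : ℕ) (hN : 0 < N) (h1 : 3 * N ≤ 2 * m) (h2 : 2 * m ≤ 5 * N) :
    T0 N - 4 * exp (-(π * N / 2)) ≤
      ∑ n ∈ Finset.Icc N (3 * N), exp (-(2 * π / N) * ((m:ℝ) - n)^2) := by
  have hN' : (0:ℝ) < N := by exact_mod_cast hN
  have hs := summ (2 * π / N) (by positivity)
  have hs1 : Summable (fun n : ℕ => exp (-(2 * π / N) * (((n:ℤ):ℝ))^2)) :=
    hs.comp_injective Nat.cast_injective
  have hs2 : Summable (fun n : ℕ => exp (-(2 * π / N) * ((-((n:ℤ)+1) : ℤ):ℝ)^2)) :=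
    hs.comp_injective (i := fun n : ℕ => (-((n:ℤ)+1) : ℤ)) (fun a b h => by simp only at h; omega)
  have e := tsum_of_nat_of_neg_add_one (f := fun n : ℤ => exp (-(2 * π / N) * (n:ℝ)^2)) hs1 hs2
  have t1 := tail N (3 * N + 1 - m) hN (by omega)
  have t2 := tail N (m - N + 1) hN (by omega)
  have f1 := hs1.sum_add_tsum_nat_add (3 * N + 1 - m)
  have f2 := hs2.sum_add_tsum_nat_add (m - N)
  have g1 : ∑' i : ℕ, exp (-(2 * π / N) * ((((i + (3 * N + 1 - m) : ℕ):ℤ):ℝ))^2)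
      = ∑' i : ℕ, exp (-(2 * π / N) * ((i:ℝ) + (3 * N + 1 - m : ℕ))^2) := by
    refine tsum_congr (fun i => ?_); push_cast; rfl
  have g2 : ∑' i : ℕ, exp (-(2 * π / N) * ((-(((i + (m - N) : ℕ):ℤ)+1) : ℤ):ℝ)^2)
      = ∑' i : ℕ, exp (-(2 * π / N) * ((i:ℝ) + (m - N + 1 : ℕ))^2) := by
    refine tsum_congr (fun i => ?_); congr 1; push_cast; ring
  have s : ∑ n ∈ Finset.Icc N (3 * N), exp (-(2 * π / N) * ((m:ℝ) - n)^2)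
      = ∑ i ∈ Finset.range (m - N), exp (-(2 * π / N) * ((-((i:ℤ)+1) : ℤ):ℝ)^2)
       + ∑ i ∈ Finset.range (3 * N + 1 - m), exp (-(2 * π / N) * (((i:ℤ):ℝ))^2) := by
    have : Finset.Icc N (3 * N) = Finset.Ico N (3 * N + 1) := by ext; simp
    rw [this, ← Finset.sum_Ico_consecutive _ (show N ≤ m by omega) (show m ≤ 3 * N + 1 by omega),
      Finset.sum_Ico_eq_sum_range, Finset.sum_Ico_eq_sum_range, ← Finset.sum_range_reflect]
    congr 1
    · refine Finset.sum_congr rfl (fun i hi => ?_)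
      have hi' := Finset.mem_range.1 hi
      have : ((m:ℝ)) = ((N + (m - N - 1 - i) : ℕ):ℝ) + i + 1 := by
        have : m = (N + (m - N - 1 - i)) + i + 1 := by omega
        exact_mod_cast this
      rw [this]; congr 1; push_cast; ring
    · refine Finset.sum_congr rfl (fun i hi => ?_)
      congr 1; push_cast; ring
  rw [g1] at f1
  rw [g2] at f2
  rw [s]
  unfold T0
  rw [e]
  linarith

lemma fin_upper (N : ℕ) (p : ℤ) (hN : 0 < N) :
      ∑ n ∈ Finset.Icc N (3 * N), exp (-(2 * π / N) * ((p:ℝ) + 1/2 - n)^2) ≤ T1 N := by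
  have hs := summ1 N hN
  have hi : Function.Injective (fun n : ℕ => p - (n:ℤ)) := fun a b h => by
    simp only at h; omega
  have := hs.sum_le_tsum ((Finset.Icc N (3 * N)).map ⟨_, hi⟩) (fun _ _ => (exp_pos _).le)
  rw [Finset.sum_map] at this
  refine le_trans (le_of_eq ?_) this
  refine Finset.sum_congr rfl (fun i _ => ?_)
  congr 1
  simp only [Function.Embedding.coeFn_mk]
  push_cast; ring

/-- unnormalised mixture -/
noncomputable def G (N : ℕ) (K a x : ℝ) : ℝ :=
  K * exp (-x^2/2) + ∑ n ∈ Finset.Icc N (3 * N), (exp (-(x + a * n)^2/2) + exp (-(x - a * n)^2/2))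

lemma mix_eq (N : ℕ) (a α x : ℝ) (hα : 0 < α) :
    GammaMix N a α x = (1 / √(2 * π)) * (α / (2 * N + 1)) *
      G N ((1 - 2 * α) * (2 * N + 1) / α) a x := by
  unfold GammaMix G stdGaussian
  simp only [← mul_add, ← Finset.mul_sum]
  field_simp

lemma poly_bound (N : ℕ) (hN : 32 ≤ N) :
    (12 * π * (3 * N + 1) * (2 * N + 1) + (2 * N + 1)) * exp (-(9 * π * N / 2))
      ≤ exp (-(π * N / 2)) := by
  have hN' : (32:ℝ) ≤ N := by exact_mod_cast hN
  have h0 : exp (-(π * N / 2)) = exp (4 * π * N) * exp (-(9 * π * N / 2)) := by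
    rw [← Real.exp_add]; congr 1; ring
  rw [h0]
  refine mul_le_mul_of_nonneg_right ?_ (exp_pos _).le
  have h1 : ((N:ℝ) + 1)^8 ≤ exp (4 * π * N) := by
    calc ((N:ℝ) + 1)^8 ≤ (exp N)^8 := by gcongr; exact Real.add_one_le_exp _
      _ = exp (8 * N) := by rw [← Real.exp_nat_mul]; norm_num
      _ ≤ _ := by apply Real.exp_le_exp.2; nlinarith [Real.pi_gt_three]
  refine le_trans ?_ h1
  have h2 : 12 * π * (3 * N + 1) * (2 * N + 1) ≤ 48 * (3 * (N:ℝ) + 1) * (2 * N + 1) := by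
    gcongr; linarith [Real.pi_lt_four]
  have h3 : 48 * (3 * (N:ℝ) + 1) * (2 * N + 1) + (2 * N + 1) ≤ 1000 * ((N:ℝ)+1)^2 := by nlinarith
  have h4 : (1000:ℝ) ≤ ((N:ℝ)+1)^6 := by
    calc (1000:ℝ) ≤ 33^6 := by norm_num
      _ ≤ _ := by gcongr; linarith
  have h5 : 1000 * ((N:ℝ)+1)^2 ≤ ((N:ℝ)+1)^6 * ((N:ℝ)+1)^2 := by gcongr
  calc _ ≤ ((N:ℝ)+1)^6 * ((N:ℝ)+1)^2 := by linarith
    _ = _ := by ring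

lemma G_lt (N m : ℕ) (p : ℤ) (a K : ℝ) (hN : 32 ≤ N) (ha : 0 < a) (ha2 : a^2 = 4 * π / N)
    (hK : 0 ≤ K) (hK2 : K ≤ 12 * π * (3 * N + 1) * (2 * N + 1))
    (h1 : 3 * N ≤ 2 * m) (h2 : 2 * m ≤ 5 * N) (hp : 3 * N ≤ 2 * p + 1) :
    G N K a (a * (p + 1/2)) < G N K a (a * m) := by
  have hN' : (32:ℝ) ≤ N := by exact_mod_cast hN
  have hp' : 3 * (N:ℝ) / 2 ≤ (p:ℝ) + 1/2 := by
    have : (3 * (N:ℝ)) ≤ 2 * p + 1 := by exact_mod_cast hp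
    linarith
  have lo : T0 N - 4 * exp (-(π * N / 2)) ≤ G N K a (a * m) := by
    refine (fin_lower N m (by omega) h1 h2).trans ?_
    unfold G
    refine le_trans ?_ (le_add_of_nonneg_left (by positivity))
    refine Finset.sum_le_sum (fun n _ => ?_)
    refine le_trans (le_of_eq ?_) (le_add_of_nonneg_left (exp_pos _).le)
    congr 1
    rw [show -(a * (m:ℝ) - a * n)^2/2 = -(a^2 * (m - n)^2)/2 by ring, ha2]
    field_simp; ring
  have hx : ∀ y : ℝ, 0 ≤ y → exp (-(a * (p + 1/2) + y)^2/2) ≤ exp (-(9 * π * N / 2)) := by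
    intro y hy
    apply Real.exp_le_exp.2
    have q : 9 * π * N = a^2 * (3 * (N:ℝ) / 2)^2 := by rw [ha2]; field_simp; ring
    have : a^2 * (3 * (N:ℝ) / 2)^2 ≤ (a * (p + 1/2) + y)^2 := by
      rw [← mul_pow]
      have := mul_le_mul_of_nonneg_left hp' ha.le
      gcongr
      linarith
    linarith
  have up : G N K a (a * (p + 1/2)) ≤ T1 N + (K + (2 * N + 1)) * exp (-(9 * π * N / 2)) := by
    unfold G
    rw [Finset.sum_add_distrib]
    have u0 := hx 0 le_rfl
    rw [add_zero] at u0
    have u1 := mul_le_mul_of_nonneg_left u0 hK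
    have u2 : ∑ n ∈ Finset.Icc N (3 * N), exp (-(a * ((p:ℝ) + 1/2) + a * n)^2/2)
        ≤ (2 * N + 1) * exp (-(9 * π * N / 2)) := by
      have hb : ∀ n ∈ Finset.Icc N (3 * N), exp (-(a * ((p:ℝ) + 1/2) + a * (n:ℝ))^2/2)
          ≤ exp (-(9 * π * N / 2)) := fun n _ => hx (a * (n:ℝ)) (by positivity)
      refine (Finset.sum_le_card_nsmul _ _ _ hb).trans ?_
      rw [nsmul_eq_mul, Nat.card_Icc]
      have : 3 * N + 1 - N = 2 * N + 1 := by omega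
      rw [this]; push_cast; rfl
    have u3 : ∑ n ∈ Finset.Icc N (3 * N), exp (-(a * ((p:ℝ) + 1/2) - a * n)^2/2) ≤ T1 N := by
      refine le_trans (le_of_eq ?_) (fin_upper N p (by omega))
      refine Finset.sum_congr rfl (fun n _ => ?_)
      congr 1
      rw [show -(a * ((p:ℝ) + 1/2) - a * n)^2/2 = -(a^2 * (p + 1/2 - n)^2)/2 by ring, ha2]
      field_simp; ring
    linarith
  have d := T_diff N (by omega)
  have hq : 8 ≤ √(2 * (N:ℝ)) := Real.le_sqrt_of_sq_le (by linarith)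
  have d2 := mul_le_mul_of_nonneg_right hq (exp_pos (-(π * N / 2))).le
  have pb := poly_bound N hN
  have pb2 : (K + (2 * N + 1)) * exp (-(9 * π * N / 2)) ≤
    (12 * π * (3 * N + 1) * (2 * N + 1) + (2 * N + 1)) * exp (-(9 * π * N / 2)) := by gcongr
  have := exp_pos (-(π * N / 2))
  linarith

lemma mix_neg (N : ℕ) (a α x : ℝ) : GammaMix N a α (-x) = GammaMix N a α x := by
  unfold GammaMix stdGaussian
  congr 1
  · simp
  · congr 1
    refine Finset.sum_congr rfl (fun n _ => ?_)
    rw [add_comm]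
    congr 3 <;> ring

lemma mix_cont (N : ℕ) (a α : ℝ) : Continuous (GammaMix N a α) := by
  unfold GammaMix stdGaussian
  fun_prop

lemma exists_max {f : ℝ → ℝ} (hf : Continuous f) {l c r : ℝ} (h1 : l < c) (h2 : c < r)
    (hl : f l < f c) (hr : f r < f c) : ∃ x, l < x ∧ x < r ∧ IsLocalMax f x := by
  obtain ⟨x, hx, hm⟩ := isCompact_Icc.exists_isMaxOn ⟨c, h1.le, h2.le⟩ (hf.continuousOn (s := Set.Icc l r))
  have hc : f c ≤ f x := hm ⟨h1.le, h2.le⟩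
  have a1 : l < x := lt_of_le_of_ne hx.1 (by rintro rfl; linarith)
  have a2 : x < r := lt_of_le_of_ne hx.2 (by rintro rfl; linarith)
  exact ⟨x, a1, a2, hm.isLocalMax (Icc_mem_nhds a1 a2)⟩

lemma right_side (N : ℕ) (hN : 32 ≤ N) (a α : ℝ) (ha : a = 2 * √π / √N)
    (hα : α = 1 / (12 * π * (3 * (N:ℝ) + 1))) :
    ∃ S : Finset ℝ, N - 1 ≤ S.card ∧
      (↑S : Set ℝ) ⊆ Set.Icc (3 * √(π * N)) (5 * √(π * N)) ∧
      ∀ x ∈ S, IsLocalMax (GammaMix N a α) x := by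
  have hN' : (32:ℝ) ≤ N := by exact_mod_cast hN
  have ha0 : 0 < a := by rw [ha]; positivity
  have ha2 : a^2 = 4 * π / N := by
    rw [ha, div_pow, mul_pow, Real.sq_sqrt (by positivity), Real.sq_sqrt (by positivity)]; norm_num
  have haN : a * N = 2 * √(π * N) := by
    rw [ha, Real.sqrt_mul (by positivity)]
    have : √(N:ℝ) * √N = N := Real.mul_self_sqrt (by positivity)
    have h0 : 0 < √(N:ℝ) := by positivity
    field_simp
    nlinarith
  have hα0 : 0 < α := by rw [hα]; positivity
  have hα1 : 2 * α ≤ 1 := by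
    rw [hα, mul_one_div, div_le_one (by positivity)]
    nlinarith [Real.pi_gt_three]
  set K := (1 - 2 * α) * (2 * N + 1) / α with hKd
  have hK : 0 ≤ K := by
    have : 0 ≤ 1 - 2 * α := by linarith
    positivity
  have hK2 : K ≤ 12 * π * (3 * N + 1) * (2 * N + 1) := by
    have : 12 * π * (3 * N + 1) * (2 * N + 1) = (1 * (2 * N + 1)) / α := by
      rw [hα]; field_simp
    rw [this, hKd]
    gcongr
    linarith
  have key : ∀ i : ℕ, ∃ x : ℝ, i < N - 1 →
      a * (((3 * N / 2 + 1 + i : ℕ) : ℝ) - 1/2) < x ∧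
      x < a * (((3 * N / 2 + 1 + i : ℕ) : ℝ) + 1/2) ∧ IsLocalMax (GammaMix N a α) x := by
    intro i
    by_cases hi : i < N - 1
    swap
    · exact ⟨0, fun h => absurd h hi⟩
    have hc : 0 < (1 / √(2 * π)) * (α / (2 * N + 1)) := by positivity
    obtain ⟨m, hm⟩ : ∃ m, m = 3 * N / 2 + 1 + i := ⟨_, rfl⟩
    rw [← hm]
    obtain ⟨x, h1, h2, h3⟩ := exists_max (mix_cont N a α) (l := a * ((m:ℝ) - 1/2)) (c := a * m)
      (r := a * ((m:ℝ) + 1/2)) (by nlinarith) (by nlinarith)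
      (by
        rw [mix_eq _ _ _ _ hα0, mix_eq _ _ _ _ hα0]
        refine mul_lt_mul_of_pos_left ?_ hc
        have := G_lt N m ((m:ℤ) - 1) a K hN ha0 ha2 hK hK2 (by omega) (by omega) (by omega)
        rw [show (((m:ℤ) - 1 : ℤ) : ℝ) + 1/2 = (m:ℝ) - 1/2 by push_cast; ring] at this
        exact this)
      (by
        rw [mix_eq _ _ _ _ hα0, mix_eq _ _ _ _ hα0]
        refine mul_lt_mul_of_pos_left ?_ hc
        exact G_lt N m (m:ℤ) a K hN ha0 ha2 hK hK2 (by omega) (by omega) (by omega))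
    exact ⟨x, fun _ => ⟨h1, h2, h3⟩⟩
  choose c hc using key
  have hlt : ∀ i j, i < N - 1 → j < N - 1 → i < j → c i < c j := by
    intro i j hi hj hij
    refine ((hc i hi).2.1).trans (lt_of_le_of_lt ?_ (hc j hj).1)
    apply mul_le_mul_of_nonneg_left _ ha0.le
    have : ((3 * N / 2 + 1 + i : ℕ) : ℝ) + 1 ≤ ((3 * N / 2 + 1 + j : ℕ) : ℝ) := by
      exact_mod_cast (by omega)
    linarith
  refine ⟨(Finset.range (N - 1)).image c, ?_, ?_, ?_⟩
  · rw [Finset.card_image_of_injOn, Finset.card_range]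
    intro i hi j hj hij
    have hi' := Finset.mem_range.1 (Finset.mem_coe.1 hi)
    have hj' := Finset.mem_range.1 (Finset.mem_coe.1 hj)
    rcases lt_trichotomy i j with h | h | h
    · exact absurd hij (hlt i j hi' hj' h).ne
    · exact h
    · exact absurd hij (hlt j i hj' hi' h).ne'
  · intro x hx
    simp only [Finset.coe_image, Set.mem_image, Finset.mem_coe, Finset.mem_range] at hx
    obtain ⟨i, hi, rfl⟩ := hx
    obtain ⟨h1, h2, -⟩ := hc i hi
    obtain ⟨m, hm⟩ : ∃ m, m = 3 * N / 2 + 1 + i := ⟨_, rfl⟩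
    rw [← hm] at h1 h2
    have b1 : 3 * (N:ℝ) + 1 ≤ 2 * m := by exact_mod_cast (by omega)
    have b2 : 2 * (m:ℝ) + 1 ≤ 5 * N := by exact_mod_cast (by omega)
    constructor <;> nlinarith
  · intro x hx
    obtain ⟨i, hi, rfl⟩ := Finset.mem_image.1 hx
    exact (hc i (Finset.mem_range.1 hi)).2.2

lemma neg_max {f : ℝ → ℝ} (hf : ∀ x, f (-x) = f x) {x : ℝ} (h : IsLocalMax f x) :
    IsLocalMax f (-x) := by
  have ht : Filter.Tendsto (fun y : ℝ => -y) (nhds (-x)) (nhds x) := by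
    simpa using (continuous_neg (G := ℝ)).tendsto (-x)
  have := ht.eventually h
  filter_upwards [this] with y hy
  rw [hf] at hy
  rw [hf]; exact hy

end GM

/-- For all sufficiently large N, with a = 2√π/√N and α = 1/(12π(3N+1)), the mixture Γ has
at least N − 1 distinct local maximum points in [3√(πN), 5√(πN)], and by symmetry at least
N − 1 distinct local maximum points in [−5√(πN), −3√(πN)]. -/
theorem GammaMix_many_modes :
    ∃ N₀ : ℕ, ∀ N : ℕ, N₀ ≤ N → ∀ a α : ℝ,
      a = 2 * Real.sqrt Real.pi / Real.sqrt N →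
      α = 1 / (12 * Real.pi * (3 * (N : ℝ) + 1)) →
      (∃ S : Finset ℝ,
          N - 1 ≤ S.card ∧
          (↑S : Set ℝ) ⊆
            Set.Icc (3 * Real.sqrt (Real.pi * N)) (5 * Real.sqrt (Real.pi * N)) ∧
          ∀ x ∈ S, IsLocalMax (GammaMix N a α) x) ∧
        (∃ S : Finset ℝ,
          N - 1 ≤ S.card ∧
          (↑S : Set ℝ) ⊆
            Set.Icc (-(5 * Real.sqrt (Real.pi * N))) (-(3 * Real.sqrt (Real.pi * N))) ∧
          ∀ x ∈ S, IsLocalMax (GammaMix N a α) x) := by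
  refine ⟨32, fun N hN a α ha hα => ?_⟩
  obtain ⟨S, h1, h2, h3⟩ := GM.right_side N hN a α ha hα
  refine ⟨⟨S, h1, h2, h3⟩, S.image (fun x => -x), ?_, ?_, ?_⟩
  · rwa [Finset.card_image_of_injective _ neg_injective]
  · intro x hx
    simp only [Finset.coe_image, Set.mem_image, Finset.mem_coe] at hx
    obtain ⟨y, hy, rfl⟩ := hx
    have := h2 (Finset.mem_coe.2 hy)
    exact ⟨neg_le_neg this.2, neg_le_neg this.1⟩
  · intro x hx
    obtain ⟨y, hy, rfl⟩ := Finset.mem_image.1 hx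
    exact GM.neg_max (GM.mix_neg N a α) (h3 y hy)
end

section
/- For every integer d ≥ 1 there exists a₀ > 0 such that for all a with 0 < a ≤ a₀, the periodized Gaussian F_a(x) = Σ_{n∈ℤ^d} φ_d(x − a·n) satisfies F_a(0) − sup{ F_a(x) : |x|_∞ = a/2 } ≥ 3·a^{−d}·e^{−2π²/a²}. -/
/-- View a coordinate vector as a point of Euclidean space. -/
noncomputable def toEuc (d : ℕ) (v : Fin d → ℝ) : EuclideanSpace ℝ (Fin d) :=
  (WithLp.equiv 2 (Fin d → ℝ)).symm v

/-- The periodized Gaussian on ℝ^d: F_a(x) = Σ_{n∈ℤ^d} φ_d(x − a·n). -/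
noncomputable def periodizedGaussianD (d : ℕ) (a : ℝ)
    (x : EuclideanSpace ℝ (Fin d)) : ℝ :=
  ∑' n : Fin d → ℤ, stdGaussianD d (x - toEuc d (fun i => a * (n i : ℝ)))

noncomputable def pgG (a t : ℝ) : ℝ :=
  ∑' n : ℤ, (2 * Real.pi) ^ (-(1:ℝ) / 2) * Real.exp (-(t - a * (n : ℝ)) ^ 2 / 2)

lemma pg_summable_aux (T S : ℝ) (hT : 0 < T) :
    Summable (fun n : ℤ => Real.exp (-(T * (n:ℝ) ^ 2) + S * n)) := by
  have h := summable_pow_mul_jacobiTheta₂_term_bound (|S| / (2 * Real.pi))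
    (T := T / Real.pi) (by positivity) 0
  refine Summable.of_nonneg_of_le (fun n => (Real.exp_pos _).le) (fun n => ?_) h
  rw [pow_zero, one_mul]
  apply Real.exp_le_exp.mpr
  have hp := Real.pi_pos.ne'
  have : -Real.pi * (T / Real.pi * (n:ℝ) ^ 2 - 2 * (|S| / (2 * Real.pi)) * ((|n| : ℤ) : ℝ))
      = -(T * (n:ℝ)^2) + |S| * |(n:ℝ)| := by
    push_cast
    field_simp
    ring
  have h2 : S * n ≤ |S| * |(n:ℝ)| := by rw [← abs_mul]; exact le_abs_self _
  push_cast at this ⊢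
  rw [this]
  linarith

lemma pg_summable_s18 (a t : ℝ) (ha : 0 < a) :
    Summable (fun n : ℤ => (2 * Real.pi) ^ (-(1:ℝ) / 2) *
      Real.exp (-(t - a * (n : ℝ)) ^ 2 / 2)) := by
  apply Summable.mul_left
  have h := (pg_summable_aux (a ^ 2 / 2) (a * t) (by positivity)).mul_left (Real.exp (-t^2/2))
  refine h.congr (fun n => ?_)
  rw [← Real.exp_add]
  congr 1
  ring

lemma pg_summable_q (a : ℝ) (ha : 0 < a) :
    Summable (fun n : ℤ => Real.exp (-2 * Real.pi ^ 2 / a ^ 2 * (n:ℝ) ^ 2)) := by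
  refine (pg_summable_aux (2 * Real.pi ^ 2 / a ^ 2) 0 (by positivity)).congr (fun n => ?_)
  congr 1
  ring

lemma pg_summable_qcos (a t : ℝ) (ha : 0 < a) :
    Summable (fun n : ℤ => Real.exp (-2 * Real.pi ^ 2 / a ^ 2 * (n:ℝ) ^ 2) *
      Real.cos (2 * Real.pi * t / a * n)) := by
  refine (pg_summable_q a ha).of_norm_bounded (fun n => ?_)
  rw [norm_mul, Real.norm_eq_abs, Real.norm_eq_abs, abs_of_pos (Real.exp_pos _)]
  exact mul_le_of_le_one_right (Real.exp_pos _).le (Real.abs_cos_le_one _)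

lemma pgG_eq (a t : ℝ) (ha : 0 < a) :
    pgG a t = 1 / a * ∑' n : ℤ, Real.exp (-2 * Real.pi ^ 2 / a ^ 2 * (n:ℝ) ^ 2) *
      Real.cos (2 * Real.pi * t / a * n) := by
  have hp := Real.pi_pos
  have hp' : (Real.pi : ℂ) ≠ 0 := by exact_mod_cast hp.ne'
  have ha' : (a : ℂ) ≠ 0 := by exact_mod_cast ha.ne'
  have hb : (0:ℝ) < 2 * Real.pi / a ^ 2 := by positivity
  have key := Complex.tsum_exp_neg_quadratic (a := ((2 * Real.pi / a ^ 2 : ℝ) : ℂ))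
    (by rw [Complex.ofReal_re]; exact hb) (Complex.I * ((t / a : ℝ) : ℂ))
  have h1 : ∀ n : ℤ, Complex.exp (-(Real.pi:ℂ) / ((2 * Real.pi / a ^ 2 : ℝ) : ℂ) *
      ((n:ℂ) + Complex.I * (Complex.I * ((t / a : ℝ) : ℂ))) ^ 2) =
      ((Real.exp (-(t - a * (n : ℝ)) ^ 2 / 2) : ℝ) : ℂ) := by
    intro n
    rw [← mul_assoc, Complex.I_mul_I]
    push_cast
    congr 1
    field_simp
    ring
  simp_rw [h1] at key
  rw [← Complex.ofReal_tsum] at key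
  have h2 : (1 : ℂ) / ((2 * Real.pi / a ^ 2 : ℝ) : ℂ) ^ (1 / 2 : ℂ)
      = ((a * (2 * Real.pi) ^ (-(1:ℝ)/2) : ℝ) : ℂ) := by
    have : (1 / 2 : ℂ) = ((1/2 : ℝ) : ℂ) := by push_cast; rfl
    rw [this, ← Complex.ofReal_cpow hb.le, ← Complex.ofReal_one, ← Complex.ofReal_div]
    congr 1
    rw [Real.div_rpow (by positivity) (by positivity), ← Real.sqrt_eq_rpow (a^2),
      Real.sqrt_sq ha.le, neg_div, Real.rpow_neg (by positivity)]
    field_simp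
  rw [h2, ← Complex.ofReal_mul] at key
  have key2 := congrArg Complex.re key
  rw [Complex.ofReal_re] at key2
  have hre : ∀ n : ℤ, (Complex.exp (-(Real.pi:ℂ) * ((2 * Real.pi / a ^ 2 : ℝ) : ℂ) * (n:ℂ) ^ 2 +
      2 * Real.pi * (Complex.I * ((t / a : ℝ) : ℂ)) * n)) =
      ((Real.exp (-2 * Real.pi ^ 2 / a ^ 2 * (n:ℝ) ^ 2) : ℝ) : ℂ) *
      Complex.exp (((2 * Real.pi * t / a * n : ℝ) : ℂ) * Complex.I) := by
    intro n
    rw [Complex.ofReal_exp, ← Complex.exp_add]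
    congr 1
    push_cast
    ring
  simp_rw [hre] at key2
  have hs : Summable (fun n : ℤ => ((Real.exp (-2 * Real.pi ^ 2 / a ^ 2 * (n:ℝ) ^ 2) : ℝ) : ℂ) *
      Complex.exp (((2 * Real.pi * t / a * n : ℝ) : ℂ) * Complex.I)) := by
    refine (pg_summable_q a ha).of_norm_bounded (fun n => ?_)
    rw [norm_mul, Complex.norm_exp_ofReal_mul_I, mul_one, Complex.norm_real, Real.norm_eq_abs,
      abs_of_pos (Real.exp_pos _)]
  rw [Complex.re_tsum hs] at key2
  simp_rw [Complex.re_ofReal_mul, Complex.exp_ofReal_mul_I_re] at key2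
  rw [key2, pgG, tsum_mul_left]
  field_simp

lemma pgG_le (a t : ℝ) (ha : 0 < a) : pgG a t ≤ pgG a 0 := by
  rw [pgG_eq a t ha, pgG_eq a 0 ha]
  refine mul_le_mul_of_nonneg_left ?_ (by positivity)
  refine (pg_summable_qcos a t ha).tsum_le_tsum (fun n => ?_) (pg_summable_qcos a 0 ha)
  refine mul_le_mul_of_nonneg_left ?_ (Real.exp_pos _).le
  simpa using Real.cos_le_one _

lemma pgG_nonneg (a t : ℝ) : 0 ≤ pgG a t :=
  tsum_nonneg (fun n => by positivity)

lemma pgG_zero_ge (a : ℝ) (ha : 0 < a) : 1 / a ≤ pgG a 0 := by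
  rw [pgG_eq a 0 ha]
  refine le_mul_of_one_le_right (by positivity) ?_
  have := (pg_summable_qcos a 0 ha).sum_le_tsum {0} (fun n _ => by simp; positivity)
  simpa using this

lemma pgG_gap (a t : ℝ) (ha : 0 < a) (ht : |t| = a / 2) :
    4 / a * Real.exp (-2 * Real.pi ^ 2 / a ^ 2) ≤ pgG a 0 - pgG a t := by
  rw [pgG_eq a t ha, pgG_eq a 0 ha, ← mul_sub,
    ← (pg_summable_qcos a 0 ha).tsum_sub (pg_summable_qcos a t ha)]
  have h := ((pg_summable_qcos a 0 ha).sub (pg_summable_qcos a t ha)).sum_le_tsum {1, -1}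
    (fun n _ => by
      rw [← mul_sub]
      refine mul_nonneg (Real.exp_pos _).le ?_
      simpa using Real.cos_le_one _)
  have hc : Real.cos (2 * Real.pi * t / a) = -1 := by
    rcases (abs_eq (by positivity)).mp ht with h | h
    · rw [h, show 2 * Real.pi * (a / 2) / a = Real.pi by field_simp, Real.cos_pi]
    · rw [h, show 2 * Real.pi * (-(a / 2)) / a = -Real.pi by field_simp, Real.cos_neg, Real.cos_pi]
  rw [Finset.sum_pair (by norm_num)] at h
  simp only [Int.cast_one, Int.cast_neg, mul_one, mul_neg, Real.cos_neg, hc, neg_sq, one_pow,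
    mul_zero, zero_div, Real.cos_zero, zero_mul, neg_zero] at h
  rw [div_eq_mul_one_div, mul_comm (4:ℝ), mul_assoc]
  refine mul_le_mul_of_nonneg_left ?_ (by positivity)
  simp only [mul_zero, zero_div, zero_mul, Real.cos_zero, mul_one] at h ⊢
  linarith

lemma pg_hasSum_mul {α β : Type} (f : α → ℝ) (g : β → ℝ) {s t : ℝ} (hf : HasSum f s)
    (hg : HasSum g t) (f0 : ∀ n, 0 ≤ f n) (g0 : ∀ n, 0 ≤ g n) :
    HasSum (fun x : α × β => f x.1 * g x.2) (s * t) :=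
  hf.mul hg (hf.summable.mul_of_nonneg hg.summable f0 g0)

lemma pg_hasSum_pi (d : ℕ) (f : Fin d → ℤ → ℝ) (hf : ∀ i, Summable (f i))
    (h0 : ∀ i n, 0 ≤ f i n) :
    HasSum (fun n : Fin d → ℤ => ∏ i, f i (n i)) (∏ i, ∑' k, f i k) := by
  induction d with
  | zero =>
    have := hasSum_fintype (fun n : Fin 0 → ℤ => ∏ i, f i (n i))
    simpa using this
  | succ d ih =>
    have h1 : HasSum (fun n : Fin d → ℤ => ∏ i, f i.succ (n i)) (∏ i : Fin d, ∑' k, f i.succ k) :=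
      ih (fun i => f i.succ) (fun i => hf i.succ) (fun i n => h0 i.succ n)
    have h2 : HasSum (fun k => f 0 k) (∑' k, f 0 k) := (hf 0).hasSum
    have hp : ∀ n : Fin d → ℤ, 0 ≤ ∏ i, f i.succ (n i) :=
      fun n => Finset.prod_nonneg (fun i _ => h0 _ _)
    have h3 := pg_hasSum_mul _ _ h2 h1 (fun n => h0 0 n) hp
    rw [← (Fin.consEquiv (fun _ : Fin (d+1) => ℤ)).hasSum_iff, Fin.prod_univ_succ]
    convert h3 using 1
    funext x
    simp [Fin.prod_univ_succ, Fin.consEquiv]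

lemma periodizedGaussianD_eq (d : ℕ) (a : ℝ) (ha : 0 < a) (x : EuclideanSpace ℝ (Fin d)) :
    periodizedGaussianD d a x = ∏ i, pgG a (x i) := by
  have h := (pg_hasSum_pi d (fun i (n : ℤ) => (2 * Real.pi) ^ (-(1:ℝ) / 2) *
      Real.exp (-(x i - a * (n : ℝ)) ^ 2 / 2)) (fun i => pg_summable_s18 a (x i) ha)
      (fun i n => by positivity)).tsum_eq
  unfold periodizedGaussianD
  simp only [pgG]
  rw [← h]
  congr 1
  funext n
  rw [Finset.prod_mul_distrib, ← Real.exp_sum, Finset.prod_const, Finset.card_univ,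
    Fintype.card_fin, ← Real.rpow_natCast, ← Real.rpow_mul (by positivity), stdGaussianD,
    EuclideanSpace.norm_sq_eq]
  congr 2
  · ring
  · rw [← Finset.sum_div, Finset.sum_neg_distrib]
    simp [toEuc, Real.norm_eq_abs, sq_abs]

/-- For every `d ≥ 1` there is `a₀ > 0` such that for all `0 < a ≤ a₀`,
F_a(0) − sup{ F_a(x) : |x|_∞ = a/2 } ≥ 3·a^{−d}·e^{−2π²/a²},
where |x|_∞ = max_i |x_i| is the ℓ^∞-norm. -/
theorem periodizedGaussianD_peak_gap (d : ℕ) (hd : 1 ≤ d) :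
    ∃ a₀ : ℝ, 0 < a₀ ∧ ∀ a : ℝ, 0 < a → a ≤ a₀ →
      (3 / a ^ d) * Real.exp (-2 * Real.pi ^ 2 / a ^ 2) ≤
        periodizedGaussianD d a 0 -
          sSup (periodizedGaussianD d a ''
            {x : EuclideanSpace ℝ (Fin d) | (⨆ i, |x i|) = a / 2}) := by
  refine ⟨1, one_pos, fun a ha _ => ?_⟩
  have : Nonempty (Fin d) := ⟨⟨0, hd⟩⟩
  rw [le_sub_comm]
  apply csSup_le
  · refine Set.Nonempty.image _ ⟨toEuc d (fun _ => a / 2), ?_⟩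
    simp [toEuc]
    positivity
  rintro _ ⟨x, hx, rfl⟩
  obtain ⟨j, hj⟩ := exists_eq_ciSup_of_finite (f := fun i => |x i|)
  have hxj : |x j| = a / 2 := hj.trans hx
  have hgap := pgG_gap a (x j) ha hxj
  rw [periodizedGaussianD_eq d a ha, periodizedGaussianD_eq d a ha,
    ← Finset.mul_prod_erase Finset.univ (fun i => pgG a (x i)) (Finset.mem_univ j)]
  have hcard : (Finset.univ.erase j).card = d - 1 := by
    rw [Finset.card_erase_of_mem (Finset.mem_univ j), Finset.card_univ, Fintype.card_fin]
  have hle : ∏ i ∈ Finset.univ.erase j, pgG a (x i) ≤ pgG a 0 ^ (d - 1) := by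
    rw [← hcard, ← Finset.prod_const]
    exact Finset.prod_le_prod (fun i _ => pgG_nonneg _ _) (fun i _ => pgG_le _ _ ha)
  have h0 : ∏ i : Fin d, pgG a ((0 : EuclideanSpace ℝ (Fin d)) i)
      = pgG a 0 * pgG a 0 ^ (d - 1) := by
    rw [← pow_succ', Nat.sub_add_cancel hd]
    simp
  rw [h0]
  have h1 := mul_le_mul_of_nonneg_left hle (pgG_nonneg a (x j))
  have hge : (1 / a) ^ (d - 1) ≤ pgG a 0 ^ (d - 1) :=
    pow_le_pow_left₀ (by positivity) (pgG_zero_ge a ha) _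
  have h2 : (4 / a * Real.exp (-2 * Real.pi ^ 2 / a ^ 2)) * (1 / a) ^ (d - 1) ≤
      (pgG a 0 - pgG a (x j)) * pgG a 0 ^ (d - 1) :=
    mul_le_mul hgap hge (by positivity) (le_trans (by positivity) hgap)
  have h3 : (4 / a * Real.exp (-2 * Real.pi ^ 2 / a ^ 2)) * (1 / a) ^ (d - 1)
      = 4 / a ^ d * Real.exp (-2 * Real.pi ^ 2 / a ^ 2) := by
    have : a ^ d = a * a ^ (d - 1) := by rw [← pow_succ', Nat.sub_add_cancel hd]
    rw [this, one_div, inv_pow]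
    field_simp
  have h4 : 3 / a ^ d * Real.exp (-2 * Real.pi ^ 2 / a ^ 2) ≤
      4 / a ^ d * Real.exp (-2 * Real.pi ^ 2 / a ^ 2) := by
    gcongr
    norm_num
  nlinarith
end
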